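/- arXiv:0704.3410 — 3 statements merged into one kernel-verified Lean document; each statement's English description precedes it below -/
import Mathlib

section
/- Let 𝔽_q be a finite field with q elements and K a field extension of 𝔽_q. Let V and W be finite-dimensional 𝔽_q-subspaces of K with dim_{𝔽_q} V = s and dim_{𝔽_q} W = r. Let F ∈ K[y_1, …, y_n] be a polynomial of total degree at most d, with d ≥ 1, such that F(f_1, …, f_n) ∈ W whenever f_1, …, f_n ∈ V. Then for every natural number κ satisfying κ·d ≤ s·n − r·d (as integers), q^κ divides the cardinality of the set {(f_1, …, f_n) ∈ V^n : F(f_1, …, f_n) = 0}. In other words, ord_q #{f ∈ V^n : F(f) = 0} ≥ (sn − rd)/d. -/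
open scoped fwdDiff

section Differences

variable {A : Type*} [AddCommGroup A]

lemma fwdDiff_mul_ring {R : Type*} [Ring R] (h : A) (f g : A → R) :
    Δ_[h] (f * g) = Δ_[h] f * g + f * Δ_[h] g + Δ_[h] f * Δ_[h] g :=
  fwdDiff_smul h f g

/-- `HasDegreeLT n f` says that every `n`-fold iterated difference of `f` vanishes. -/
def HasDegreeLT {B : Type*} [AddCommGroup B] : ℕ → (A → B) → Prop
  | 0, f => f = 0
  | n + 1, f => ∀ h : A, HasDegreeLT n (Δ_[h] f)

namespace HasDegreeLT

variable {B C K : Type*} [AddCommGroup B] [AddCommGroup C] [CommRing K]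

lemma zero (n : ℕ) : HasDegreeLT n (0 : A → B) := by
  induction n with
  | zero => rfl
  | succ n ih =>
    intro h
    convert ih using 1
    ext x
    simp [fwdDiff]

lemma succ {n : ℕ} {f : A → B} (hf : HasDegreeLT n f) : HasDegreeLT (n + 1) f := by
  induction n generalizing f with
  | zero =>
    obtain rfl : f = 0 := hf
    exact zero 1
  | succ n ih => exact fun h ↦ ih (hf h)

lemma mono {m n : ℕ} (hmn : m ≤ n) {f : A → B} (hf : HasDegreeLT m f) : HasDegreeLT n f :=
  Nat.le_induction hf (fun _ _ h ↦ h.succ) n hmn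

lemma add {n : ℕ} {f g : A → B} (hf : HasDegreeLT n f) (hg : HasDegreeLT n g) :
    HasDegreeLT n (f + g) := by
  induction n generalizing f g with
  | zero =>
    obtain rfl : f = 0 := hf
    obtain rfl : g = 0 := hg
    exact add_zero 0
  | succ n ih =>
    intro h
    rw [fwdDiff_add]
    exact ih (hf h) (hg h)

lemma sum {ι : Type*} {n : ℕ} (s : Finset ι) {f : ι → A → B}
    (hf : ∀ i ∈ s, HasDegreeLT n (f i)) : HasDegreeLT n (∑ i ∈ s, f i) :=
  Finset.sum_induction f (HasDegreeLT n) (fun _ _ ↦ add) (zero n) hf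

lemma const (b : B) : HasDegreeLT 1 (fun _ : A ↦ b) := fun h ↦ fwdDiff_const h b

lemma addMonoidHom (φ : A →+ B) : HasDegreeLT 2 φ := by
  intro h
  have : Δ_[h] φ = fun _ ↦ φ h := by
    ext x
    simp [fwdDiff]
  rw [this]
  exact const _

lemma of_comp {n : ℕ} {f : A → B} (φ : B →+ C) (hφ : Function.Injective φ)
    (hf : HasDegreeLT n (φ ∘ f)) : HasDegreeLT n f := by
  induction n generalizing f with
  | zero =>
    ext x
    exact hφ (by simpa using congrFun hf x)
  | succ n ih =>
    intro h
    refine ih ?_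
    convert hf h using 1
    ext x
    simp [fwdDiff]

lemma mul {m n : ℕ} {f g : A → K} (hf : HasDegreeLT m f) (hg : HasDegreeLT n g) :
    HasDegreeLT (m + n - 1) (f * g) := by
  induction hN : m + n generalizing m n f g with
  | zero =>
    obtain rfl : m = 0 := by omega
    obtain rfl : f = 0 := hf
    simpa using zero _
  | succ N ih =>
    rcases m with _ | m
    · obtain rfl : f = 0 := hf
      simpa using zero _
    rcases n with _ | n
    · obtain rfl : g = 0 := hg
      simpa using zero _
    obtain ⟨N, rfl⟩ : ∃ N', N = N' + 1 := ⟨N - 1, by omega⟩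
    intro h
    rw [fwdDiff_mul_ring]
    refine add (add (ih (hf h) hg (by omega)) (ih hf (hg h) (by omega))) ?_
    exact ih (hf h).succ (hg h) (by omega)

lemma pow {f : A → K} (hf : HasDegreeLT 2 f) (k : ℕ) : HasDegreeLT (k + 1) (f ^ k) := by
  induction k with
  | zero =>
    rw [pow_zero]
    exact const (1 : K)
  | succ k ih =>
    rw [pow_succ]
    exact ih.mul hf

lemma prod {ι : Type*} (s : Finset ι) {f : ι → A → K} {u : ι → ℕ}
    (hf : ∀ i ∈ s, HasDegreeLT (u i + 1) (f i)) :
    HasDegreeLT (∑ i ∈ s, u i + 1) (∏ i ∈ s, f i) := by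
  classical
  induction s using Finset.induction_on with
  | empty => exact const (1 : K)
  | insert i s hi ih =>
    rw [Finset.sum_insert hi, Finset.prod_insert hi]
    refine mono (by omega) ((hf i (by simp)).mul (ih fun j hj ↦ hf j (by simp [hj])))

/-- Evaluating a polynomial of total degree at most `d` at additive functions gives a function
all of whose `(d + 1)`-fold differences vanish. -/
lemma mvPolynomial_eval {σ : Type*} [Fintype σ] (φ : σ → A →+ K) {d : ℕ} (F : MvPolynomial σ K)
    (hF : F.totalDegree ≤ d) :
    HasDegreeLT (d + 1) (fun x ↦ MvPolynomial.eval (fun i ↦ φ i x) F) := by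
  have : (fun x ↦ MvPolynomial.eval (fun i ↦ φ i x) F) =
      ∑ u ∈ F.support, (fun _ ↦ F.coeff u) * ∏ i, (φ i : A → K) ^ u i := by
    ext x
    simp [MvPolynomial.eval_eq']
  rw [this]
  refine sum _ fun u hu ↦ ?_
  have hu' : ∑ i, u i ≤ d := by
    refine le_trans ?_ hF
    have := MvPolynomial.le_totalDegree hu
    rwa [Finsupp.sum_fintype _ _ (fun _ ↦ rfl)] at this
  refine mono ?_ ((const (F.coeff u)).mul (prod Finset.univ fun i _ ↦ (addMonoidHom (φ i)).pow (u i)))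
  omega

end HasDegreeLT

/-- `HasDifferencesIn I n w f` says that for `k ≤ n` every `k`-fold iterated difference of `f`
takes values in `I (w + k)`. -/
def HasDifferencesIn {R : Type*} [CommRing R] (I : ℕ → AddSubgroup R) :
    ℕ → ℕ → (A → R) → Prop
  | 0, w, f => ∀ x, f x ∈ I w
  | n + 1, w, f => (∀ x, f x ∈ I w) ∧ ∀ h : A, HasDifferencesIn I n (w + 1) (Δ_[h] f)

namespace HasDifferencesIn

variable {R : Type*} [CommRing R] {I : ℕ → AddSubgroup R}

lemma apply_mem {n w : ℕ} {f : A → R} (hf : HasDifferencesIn I n w f) (x : A) : f x ∈ I w := by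
  cases n with
  | zero => exact hf x
  | succ n => exact hf.1 x

lemma zero (n w : ℕ) : HasDifferencesIn I n w (0 : A → R) := by
  induction n generalizing w with
  | zero => exact fun _ ↦ zero_mem _
  | succ n ih =>
    refine ⟨fun _ ↦ zero_mem _, fun h ↦ ?_⟩
    convert ih (w + 1) using 1
    ext x
    simp [fwdDiff]

lemma add {n w : ℕ} {f g : A → R} (hf : HasDifferencesIn I n w f)
    (hg : HasDifferencesIn I n w g) : HasDifferencesIn I n w (f + g) := by
  induction n generalizing w f g with
  | zero => exact fun x ↦ add_mem (hf x) (hg x)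
  | succ n ih =>
    refine ⟨fun x ↦ add_mem (hf.1 x) (hg.1 x), fun h ↦ ?_⟩
    rw [fwdDiff_add]
    exact ih (hf.2 h) (hg.2 h)

lemma sum {ι : Type*} {n w : ℕ} (s : Finset ι) {f : ι → A → R}
    (hf : ∀ i ∈ s, HasDifferencesIn I n w (f i)) : HasDifferencesIn I n w (∑ i ∈ s, f i) :=
  Finset.sum_induction f (HasDifferencesIn I n w) (fun _ _ ↦ add) (zero n w) hf

lemma of_succ {n w : ℕ} {f : A → R} (hf : HasDifferencesIn I (n + 1) w f) :
    HasDifferencesIn I n w f := by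
  induction n generalizing w f with
  | zero => exact hf.1
  | succ n ih => exact ⟨hf.1, fun h ↦ ih (hf.2 h)⟩

lemma of_le {m n w : ℕ} (hmn : m ≤ n) {f : A → R} (hf : HasDifferencesIn I n w f) :
    HasDifferencesIn I m w f :=
  Nat.decreasingInduction (motive := fun k _ ↦ HasDifferencesIn I k w f)
    (fun _ _ h ↦ h.of_succ) hf hmn

lemma weight_anti (hI : Antitone I) {n v w : ℕ} (hvw : v ≤ w) {f : A → R}
    (hf : HasDifferencesIn I n w f) : HasDifferencesIn I n v f := by
  induction n generalizing v w f with
  | zero => exact fun x ↦ hI hvw (hf x)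
  | succ n ih => exact ⟨fun x ↦ hI hvw (hf.1 x), fun h ↦ ih (by omega) (hf.2 h)⟩

lemma const {w : ℕ} {c : R} (hc : c ∈ I w) (n : ℕ) :
    HasDifferencesIn I n w (fun _ : A ↦ c) := by
  cases n with
  | zero => exact fun _ ↦ hc
  | succ n =>
    refine ⟨fun _ ↦ hc, fun h ↦ ?_⟩
    rw [fwdDiff_const]
    exact zero _ _

lemma mul [SetLike.GradedMonoid I] (hI : Antitone I) {n v w : ℕ} {f g : A → R}
    (hf : HasDifferencesIn I n v f) (hg : HasDifferencesIn I n w g) :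
    HasDifferencesIn I n (v + w) (f * g) := by
  induction n generalizing v w f g with
  | zero => exact fun x ↦ SetLike.mul_mem_graded (hf x) (hg x)
  | succ n ih =>
    refine ⟨fun x ↦ SetLike.mul_mem_graded (hf.1 x) (hg.1 x), fun h ↦ ?_⟩
    rw [fwdDiff_mul_ring]
    refine add (add ?_ ?_) ?_
    · exact (ih (hf.2 h) hg.of_succ).weight_anti hI (by omega)
    · exact (ih hf.of_succ (hg.2 h)).weight_anti hI (by omega)
    · exact (ih (hf.2 h) (hg.2 h)).weight_anti hI (by omega)

lemma fwdDiff_iterate {n w : ℕ} {f : A → R} (a : ℕ) (b : A)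
    (hf : HasDifferencesIn I (n + a) w f) : HasDifferencesIn I n (w + a) ((Δ_[b])^[a] f) := by
  induction a generalizing w f with
  | zero => exact hf
  | succ a ih =>
    rw [Function.iterate_succ_apply, ← Nat.add_assoc, Nat.add_right_comm]
    exact ih (hf.2 b)

end HasDifferencesIn

lemma sum_shift_eq_sum_choose_fwdDiff {R : Type*} [CommRing R] (f : A → R) (b x : A) (m : ℕ) :
    ∑ t ∈ Finset.range m, f (x + t • b) =
      ∑ a ∈ Finset.range m, (m.choose (a + 1) : R) * (Δ_[b])^[a] f x := by
  induction m with
  | zero => simp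
  | succ m ih =>
    rw [Finset.sum_range_succ, ih, shift_eq_sum_fwdDiff_iter b f, Finset.sum_range_succ,
      Finset.sum_range_succ _ m, ← add_assoc, ← Finset.sum_add_distrib]
    congr 1
    · refine Finset.sum_congr rfl fun a _ ↦ ?_
      rw [Nat.choose_succ_succ]
      push_cast
      rw [nsmul_eq_mul]
      ring
    · simp

namespace HasDifferencesIn

variable {R : Type*} [CommRing R] {I : ℕ → AddSubgroup R} {p : ℕ}

/-- Summing over the multiples of an element raises the weight by `p - 1`. -/
lemma sum_range_shift [SetLike.GradedMonoid I] (hI : Antitone I) (hp : p.Prime)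
    (hpI : (p : R) ∈ I (p - 1)) {n w : ℕ} {f : A → R}
    (hf : HasDifferencesIn I (n + (p - 1)) w f) (b : A) :
    HasDifferencesIn I n (w + (p - 1)) (fun x ↦ ∑ t ∈ Finset.range p, f (x + t • b)) := by
  have : (fun x ↦ ∑ t ∈ Finset.range p, f (x + t • b)) =
      ∑ a ∈ Finset.range p, (fun _ ↦ (p.choose (a + 1) : R)) * (Δ_[b])^[a] f := by
    ext x
    simp [sum_shift_eq_sum_choose_fwdDiff]
  rw [this]
  refine sum _ fun a ha ↦ ?_
  rw [Finset.mem_range] at ha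
  have hΔ : HasDifferencesIn I n (w + a) ((Δ_[b])^[a] f) :=
    fwdDiff_iterate a b (hf.of_le (by omega))
  rcases eq_or_ne (a + 1) p with h | h
  · obtain rfl : a = p - 1 := by omega
    convert hΔ using 1
    ext x
    simp [h]
  · obtain ⟨c, hc⟩ := hp.dvd_choose_self a.succ_ne_zero (by omega)
    have hmem : (p.choose (a + 1) : R) ∈ I (p - 1) := by
      rw [hc, mul_comm]
      push_cast
      rw [← nsmul_eq_mul]
      exact nsmul_mem hpI c
    exact ((const hmem n).mul hI hΔ).weight_anti hI (by omega)

lemma sum_zmod_combinations_mem [SetLike.GradedMonoid I] (hI : Antitone I) [hp : Fact p.Prime]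
    (hpI : (p : R) ∈ I (p - 1)) {M w : ℕ} {f : A → R}
    (hf : ∀ n, HasDifferencesIn I n w f) (b : Fin M → A) (x : A) :
    ∑ c : Fin M → ZMod p, f (x + ∑ i, (c i).val • b i) ∈ I (w + (p - 1) * M) := by
  induction M generalizing w f x with
  | zero => simpa using (hf 0).apply_mem x
  | succ M ih =>
    have key := ih (fun n ↦ (hf (n + (p - 1))).sum_range_shift hI hp.out hpI (b 0))
      (fun i ↦ b i.succ) x
    have hw : w + (p - 1) * (M + 1) = w + (p - 1) + (p - 1) * M := by ring
    rw [hw]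
    convert key using 1
    · rw [← (Fin.consEquiv fun _ ↦ ZMod p).sum_comp, Fintype.sum_prod_type_right]
      refine Finset.sum_congr rfl fun c _ ↦ ?_
      have e : ∑ t ∈ Finset.range p, f (x + ∑ i, (c i).val • b i.succ + t • b 0) =
          ∑ t : ZMod p, f (x + ∑ i, (c i).val • b i.succ + t.val • b 0) := by
        symm
        refine Finset.sum_bij (fun t _ ↦ t.val) (fun t _ ↦ by simpa using t.val_lt)
          (fun s _ t _ h ↦ ZMod.val_injective p h) (fun t ht ↦ ⟨(t : ZMod p), by simp, ?_⟩)
          (fun _ _ ↦ rfl)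
        exact ZMod.val_cast_of_lt (Finset.mem_range.1 ht)
      rw [e]
      refine Finset.sum_congr rfl fun t _ ↦ ?_
      rw [Fin.sum_univ_succ]
      simp [Fin.consEquiv, add_assoc, add_comm (∑ i, _)]

/-- The sum of `f` over an elementary abelian `p`-group of rank `M` gains weight `(p - 1) M`. -/
lemma sum_mem [SetLike.GradedMonoid I] (hI : Antitone I) [hp : Fact p.Prime]
    (hpI : (p : R) ∈ I (p - 1)) [Fintype A] (hA : ∀ x : A, p • x = 0) {M w : ℕ}
    (hM : Nat.card A = p ^ M) {f : A → R} (hf : ∀ n, HasDifferencesIn I n w f) :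
    ∑ x, f x ∈ I (w + (p - 1) * M) := by
  have : Module (ZMod p) A := AddCommGroup.zmodModule hA
  have hM' : M = Module.finrank (ZMod p) A := by
    have h := Module.card_eq_pow_finrank (K := ZMod p) (V := A)
    rw [ZMod.card, ← Nat.card_eq_fintype_card, hM] at h
    exact Nat.pow_right_injective hp.out.two_le h
  subst hM'
  let b := Module.finBasis (ZMod p) A
  convert sum_zmod_combinations_mem hI hpI hf b 0 using 1
  rw [← b.equivFun.symm.toEquiv.sum_comp]
  refine Finset.sum_congr rfl fun c _ ↦ ?_
  congr 1
  simp only [LinearEquiv.coe_toEquiv, Module.Basis.equivFun_symm_apply, zero_add]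
  refine Finset.sum_congr rfl fun i _ ↦ ?_
  rw [← Nat.cast_smul_eq_nsmul (ZMod p), ZMod.natCast_zmod_val]

end HasDifferencesIn

section AddChar

variable {R W : Type*} [CommRing R] [AddCommGroup W] {I : ℕ → AddSubgroup R}

lemma HasDegreeLT.hasDifferencesIn_addChar_sub_one [SetLike.GradedMonoid I] (hI : Antitone I)
    {d : ℕ} {ψ : AddChar W R} (hψ : ∀ y, ψ y - 1 ∈ I d) (n : ℕ) {w e : ℕ} (hwe : w + e = d)
    {g : A → W} (hg : HasDegreeLT (e + 1) g) :
    HasDifferencesIn I n w (fun x ↦ ψ (g x) - 1) := by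
  induction n generalizing w e g with
  | zero => exact fun x ↦ hI (by omega) (hψ (g x))
  | succ n ih =>
    refine ⟨fun x ↦ hI (by omega) (hψ (g x)), fun h ↦ ?_⟩
    have hΔ : Δ_[h] (fun x ↦ ψ (g x) - 1) =
        (fun x ↦ ψ (g x)) * fun x ↦ ψ (Δ_[h] g x) - 1 := by
      ext x
      have : ψ (g (x + h)) = ψ (g x) * ψ (Δ_[h] g x) := by
        rw [← AddChar.map_add_eq_mul, fwdDiff, add_sub_cancel]
      simp only [Pi.mul_apply, fwdDiff] at this ⊢
      rw [this]
      ring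
    rw [hΔ]
    have hψg : HasDifferencesIn I n 0 (fun x ↦ ψ (g x)) := by
      have := (HasDifferencesIn.const (A := A) (SetLike.one_mem_graded I) n).add
        ((ih hwe hg).weight_anti hI (Nat.zero_le w))
      convert this using 1
      ext x
      simp
    rw [← zero_add (w + 1)]
    refine hψg.mul hI ?_
    rcases e with _ | e
    · have h0 : Δ_[h] g = 0 := hg h
      convert HasDifferencesIn.zero n (w + 1) using 1
      ext x
      simp [h0]
    · exact ih (by omega) (hg h)

lemma HasDegreeLT.hasDifferencesIn_addChar [SetLike.GradedMonoid I] (hI : Antitone I)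
    {d : ℕ} {ψ : AddChar W R} (hψ : ∀ y, ψ y - 1 ∈ I d) (n : ℕ)
    {g : A → W} (hg : HasDegreeLT (d + 1) g) :
    HasDifferencesIn I n 0 (fun x ↦ ψ (g x)) := by
  convert (HasDifferencesIn.const (A := A) (SetLike.one_mem_graded I) n).add
    (hg.hasDifferencesIn_addChar_sub_one hI hψ n (zero_add d)) using 1
  ext x
  simp

end AddChar

end Differences

section RootsOfUnity

/-- The subgroup of complex numbers `π ^ k * y` with `y` an algebraic integer and `k ≥ w / d`. -/
def piAdicFiltration {π : ℂ} (hπ : IsIntegral ℤ π) (d : ℕ) [NeZero d] (w : ℕ) : AddSubgroup ℂ where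
  carrier := {x | ∃ k y, w ≤ d * k ∧ IsIntegral ℤ y ∧ x = π ^ k * y}
  zero_mem' := by
    exact ⟨w, 0, Nat.le_mul_of_pos_left w (NeZero.pos d), isIntegral_zero, by simp⟩
  add_mem' := by
    rintro _ _ ⟨k, y, hk, hy, rfl⟩ ⟨l, z, hl, hz, rfl⟩
    rcases le_total k l with h | h
    · obtain ⟨m, rfl⟩ := Nat.exists_eq_add_of_le h
      exact ⟨k, y + π ^ m * z, hk, hy.add ((hπ.pow m).mul hz), by ring⟩
    · obtain ⟨m, rfl⟩ := Nat.exists_eq_add_of_le h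
      exact ⟨l, π ^ m * y + z, hl, ((hπ.pow m).mul hy).add hz, by ring⟩
  neg_mem' := by
    rintro _ ⟨k, y, hk, hy, rfl⟩
    exact ⟨k, -y, hk, hy.neg, by ring⟩

lemma piAdicFiltration_antitone {π : ℂ} (hπ : IsIntegral ℤ π) (d : ℕ) [NeZero d] :
    Antitone (piAdicFiltration hπ d) := by
  rintro v w hvw _ ⟨k, y, hk, hy, rfl⟩
  exact ⟨k, y, hvw.trans hk, hy, rfl⟩

instance {π : ℂ} (hπ : IsIntegral ℤ π) (d : ℕ) [NeZero d] :
    SetLike.GradedMonoid (piAdicFiltration hπ d) where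
  one_mem := ⟨0, 1, by simp, isIntegral_one, by simp⟩
  mul_mem := by
    rintro v w _ _ ⟨k, y, hk, hy, rfl⟩ ⟨l, z, hl, hz, rfl⟩
    exact ⟨k + l, y * z, by rw [mul_add]; omega, hy.mul hz, by ring⟩

namespace IsPrimitiveRoot

variable {ζ : ℂ} {p : ℕ}

lemma isIntegral_sub_one (hζ : IsPrimitiveRoot ζ p) (hp : 0 < p) : IsIntegral ℤ (ζ - 1) :=
  (hζ.isIntegral hp).sub isIntegral_one

lemma exists_isIntegral_eq_sub_one_pow_mul (hζ : IsPrimitiveRoot ζ p) (hp : 0 < p) :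
    ∃ u, IsIntegral ℤ u ∧ (p : ℂ) = (ζ - 1) ^ (p - 1) * u := by
  obtain ⟨u, hu, h⟩ := hζ.self_sub_one_pow_dvd_order (k := p - 1) (by omega)
  refine ⟨u, ?_, h.trans (mul_comm _ _)⟩
  exact (Algebra.adjoin_le (S := integralClosure ℤ ℂ)
    (Set.singleton_subset_iff.2 (hζ.isIntegral hp))) hu

lemma exists_isIntegral_pow_sub_one_eq (hζ : IsIntegral ℤ ζ) (k : ℕ) :
    ∃ v, IsIntegral ℤ v ∧ ζ ^ k - 1 = (ζ - 1) * v :=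
  ⟨∑ i ∈ Finset.range k, ζ ^ i, IsIntegral.sum _ fun i _ ↦ hζ.pow i, (mul_geom_sum ζ k).symm⟩

lemma exists_isIntegral_sub_one_pow_eq (hζ : IsPrimitiveRoot ζ p) (hp : p.Prime) :
    ∃ u, IsIntegral ℤ u ∧ (ζ - 1) ^ (p - 1) = p * u := by
  have hpos := hp.pos
  have hint := hζ.isIntegral hpos
  have key : ∀ k ∈ Finset.range (p - 1),
      ∃ v, IsIntegral ℤ v ∧ ζ - 1 = (1 - ζ ^ (k + 1)) * v := by
    intro k hk
    rw [Finset.mem_range] at hk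
    have hk' : IsPrimitiveRoot (ζ ^ (k + 1)) p :=
      hζ.pow_of_coprime _ ((Nat.coprime_of_lt_prime k.succ_ne_zero (by omega) hp).symm)
    have : NeZero p := ⟨hp.ne_zero⟩
    obtain ⟨j, -, hj⟩ := hk'.eq_pow_of_pow_eq_one hζ.pow_eq_one
    obtain ⟨v, hv, h⟩ := exists_isIntegral_pow_sub_one_eq (hint.pow (k + 1)) j
    refine ⟨-v, hv.neg, ?_⟩
    rw [hj] at h
    rw [h]
    ring
  choose! v hv h using key
  refine ⟨∏ k ∈ Finset.range (p - 1), v k, IsIntegral.prod _ hv, ?_⟩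
  have hprod : ∏ k ∈ Finset.range (p - 1), (1 - ζ ^ (k + 1)) = p := by
    obtain ⟨m, rfl⟩ : ∃ m, p = m + 1 := ⟨p - 1, by omega⟩
    simpa using hζ.prod_one_sub_pow_eq_order
  rw [← hprod, ← Finset.prod_mul_distrib, ← Finset.prod_congr rfl h]
  simp

end IsPrimitiveRoot

lemma Nat.dvd_of_isIntegral_complex {m n : ℕ} (hm : m ≠ 0) {y : ℂ} (hy : IsIntegral ℤ y)
    (h : (n : ℂ) = m * y) : m ∣ n := by
  have hm' : (m : ℂ) ≠ 0 := by exact_mod_cast hm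
  have hyq : y = algebraMap ℚ ℂ (n / m) := by
    rw [map_div₀, map_natCast, map_natCast, h]
    field_simp
  rw [hyq, isIntegral_algebraMap_iff (algebraMap ℚ ℂ).injective,
    IsIntegrallyClosed.isIntegral_iff] at hy
  obtain ⟨z, hz⟩ := hy
  have hmq : (m : ℚ) ≠ 0 := by exact_mod_cast hm
  rw [eq_div_iff hmq, eq_intCast] at hz
  have : (n : ℤ) = m * z := by
    rw [mul_comm]
    exact_mod_cast hz.symm
  exact Int.natCast_dvd_natCast.1 ⟨z, this⟩

end RootsOfUnity

section Zeros

variable {A W : Type*} [AddCommGroup W] [Fintype A] [Finite W]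

lemma sum_addChar_eq_card_zeros_mul_card [Fintype (AddChar W ℂ)] (g : A → W) :
    ∑ ψ : AddChar W ℂ, ∑ x, ψ (g x) = ((Nat.card {x // g x = 0} * Nat.card W : ℕ) : ℂ) := by
  classical
  have := Fintype.ofFinite W
  rw [Finset.sum_comm]
  have h (a : W) : ∑ ψ : AddChar W ℂ, ψ a = if a = 0 then (Nat.card W : ℂ) else 0 := by
    rw [Nat.card_eq_fintype_card, ← AddChar.sum_apply_eq_ite]
    congr!
  simp_rw [h]
  rw [← Finset.sum_filter, Finset.sum_const, nsmul_eq_mul, Nat.card_eq_fintype_card (α := {x // _}),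
    Fintype.card_subtype]
  push_cast
  rfl

/-- **Ax–Katz divisibility** for maps of bounded degree between elementary abelian `p`-groups. -/
lemma HasDegreeLT.pow_dvd_card_zeros [AddCommGroup A] {p : ℕ} [hp : Fact p.Prime] (hA : ∀ x : A, p • x = 0)
    (hW : ∀ y : W, p • y = 0) {M R d κ : ℕ} (hAM : Nat.card A = p ^ M) (hWR : Nat.card W = p ^ R)
    (hd : 0 < d) {g : A → W} (hg : HasDegreeLT (d + 1) g) (hκ : (κ + R) * d ≤ M) :
    p ^ κ ∣ Nat.card {x // g x = 0} := by
  have hp0 := hp.out.pos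
  have : NeZero p := ⟨hp.out.ne_zero⟩
  have hζ := Complex.isPrimitiveRoot_exp p hp0.ne'
  set ζ := Complex.exp (2 * Real.pi * Complex.I / p)
  have hπ := hζ.isIntegral_sub_one hp0
  have : NeZero d := ⟨hd.ne'⟩
  let I := piAdicFiltration hπ d
  have hI : Antitone I := piAdicFiltration_antitone hπ d
  have hpI : (p : ℂ) ∈ I (p - 1) := by
    obtain ⟨u, hu, h⟩ := hζ.exists_isIntegral_eq_sub_one_pow_mul hp0
    exact ⟨p - 1, u, Nat.le_mul_of_pos_left _ hd, hu, h⟩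
  have hψ (ψ : AddChar W ℂ) (y : W) : ψ y - 1 ∈ I d := by
    have hy : ψ y ^ p = 1 := by rw [← AddChar.map_nsmul_eq_pow, hW, AddChar.map_zero_eq_one]
    obtain ⟨j, -, hj⟩ := hζ.eq_pow_of_pow_eq_one hy
    obtain ⟨v, hv, h⟩ :=
      IsPrimitiveRoot.exists_isIntegral_pow_sub_one_eq (hζ.isIntegral hp0) j
    exact ⟨1, v, by simp, hv, by rw [← hj, h, pow_one]⟩
  have := Fintype.ofFinite (AddChar W ℂ)
  have hmem : ∑ ψ : AddChar W ℂ, ∑ x, ψ (g x) ∈ I ((p - 1) * M) := by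
    refine sum_mem fun ψ _ ↦ ?_
    rw [← zero_add ((p - 1) * M)]
    exact HasDifferencesIn.sum_mem hI hpI hA hAM
      fun n ↦ hg.hasDifferencesIn_addChar hI (hψ ψ) n
  rw [sum_addChar_eq_card_zeros_mul_card, hWR] at hmem
  obtain ⟨k, y, hk, hy, h⟩ := hmem
  have hk' : (p - 1) * (κ + R) ≤ k := by
    refine Nat.le_of_mul_le_mul_left ?_ hd
    calc d * ((p - 1) * (κ + R)) = (p - 1) * ((κ + R) * d) := by ring
      _ ≤ (p - 1) * M := Nat.mul_le_mul_left _ hκ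
      _ ≤ d * k := hk
  obtain ⟨l, rfl⟩ := Nat.exists_eq_add_of_le hk'
  obtain ⟨u, hu, hpu⟩ := hζ.exists_isIntegral_sub_one_pow_eq hp.out
  have hdvd : p ^ (κ + R) ∣ Nat.card {x // g x = 0} * p ^ R := by
    refine Nat.dvd_of_isIntegral_complex (pow_ne_zero _ hp.out.ne_zero)
      ((hu.pow (κ + R)).mul ((hπ.pow l).mul hy)) ?_
    rw [h, pow_add, pow_mul, hpu]
    push_cast
    ring
  rw [pow_add] at hdvd
  exact Nat.dvd_of_mul_dvd_mul_right (pow_pos hp0 R) hdvd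

end Zeros


/-- Ax–Katz-type divisibility estimate: with `V`, `W` finite-dimensional
`𝔽_q`-subspaces of `K` of dimensions `s`, `r`, and `F` of total degree at most
`d ≥ 1` mapping `Vⁿ` into `W`, for every `κ` with `κ·d ≤ s·n − r·d` the power
`q^κ` divides `#{(f₁, …, fₙ) ∈ Vⁿ : F(f₁, …, fₙ) = 0}`. -/
theorem ax_katz_riemann_roch_divisibility
    {𝔽 K : Type*} [Field 𝔽] [Fintype 𝔽] [Field K] [Algebra 𝔽 K]
    (q : ℕ) (hq : Fintype.card 𝔽 = q)
    (V W : Submodule 𝔽 K) [FiniteDimensional 𝔽 V] [FiniteDimensional 𝔽 W]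
    (s r n d : ℕ)
    (hs : Module.finrank 𝔽 V = s) (hr : Module.finrank 𝔽 W = r)
    (hd : 1 ≤ d)
    (F : MvPolynomial (Fin n) K) (hFd : F.totalDegree ≤ d)
    (hFW : ∀ f : Fin n → K, (∀ j, f j ∈ V) → MvPolynomial.eval f F ∈ W) :
    ∀ κ : ℕ, (κ : ℤ) * d ≤ (s : ℤ) * n - (r : ℤ) * d →
      q ^ κ ∣ Nat.card {f : Fin n → K // (∀ j, f j ∈ V) ∧ MvPolynomial.eval f F = 0} := by
  intro κ hκ
  obtain ⟨p, hpchar⟩ := CharP.exists 𝔽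
  obtain ⟨e, hp, he⟩ := FiniteField.card 𝔽 p
  have : Fact p.Prime := ⟨hp⟩
  have : Finite V := Module.finite_of_finite 𝔽
  have : Finite W := Module.finite_of_finite 𝔽
  have := Fintype.ofFinite V
  have hpK (x : K) : p • x = 0 := by
    have hp0 : (p : K) = 0 := by
      rw [← map_natCast (algebraMap 𝔽 K), CharP.cast_eq_zero, map_zero]
    rw [nsmul_eq_mul, hp0, zero_mul]
  have hqp : q = p ^ (e : ℕ) := hq.symm.trans he
  have hcard (U : Submodule 𝔽 K) [FiniteDimensional 𝔽 U] :
      Nat.card U = p ^ (e * Module.finrank 𝔽 U) := by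
    rw [Module.natCard_eq_pow_finrank (K := 𝔽), Nat.card_eq_fintype_card, he, pow_mul]
  let g (f : Fin n → V) : W := ⟨MvPolynomial.eval (fun j ↦ (f j : K)) F, hFW _ fun j ↦ (f j).2⟩
  have hg : HasDegreeLT (d + 1) g := by
    refine HasDegreeLT.of_comp W.subtype.toAddMonoidHom W.injective_subtype ?_
    exact HasDegreeLT.mvPolynomial_eval
      (fun j ↦ V.subtype.toAddMonoidHom.comp (Pi.evalAddMonoidHom (fun _ ↦ V) j)) F hFd
  have hA : Nat.card (Fin n → V) = p ^ (e * s * n) := by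
    rw [Nat.card_fun, hcard V, hs, Nat.card_eq_fintype_card, Fintype.card_fin, ← pow_mul]
  have hW : Nat.card W = p ^ (e * r) := by rw [hcard W, hr]
  have hκ' : (κ + r) * d ≤ s * n := by
    zify
    linarith
  have hle : (e * κ + e * r) * d ≤ e * s * n := by
    calc (e * κ + e * r) * d = e * ((κ + r) * d) := by ring
      _ ≤ e * (s * n) := Nat.mul_le_mul_left _ hκ'
      _ = e * s * n := by ring
  have key := hg.pow_dvd_card_zeros (fun x ↦ by ext j; exact hpK _) (fun y ↦ Subtype.ext (hpK y))
    hA hW hd hle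
  rw [hqp, ← pow_mul]
  convert key using 1
  refine Nat.card_congr
    { toFun := fun f ↦ ⟨fun j ↦ ⟨f.1 j, f.2.1 j⟩, Subtype.ext f.2.2⟩
      invFun := fun f ↦ ⟨fun j ↦ f.1 j, fun j ↦ (f.1 j).2, congrArg Subtype.val f.2⟩
      left_inv := fun _ ↦ rfl
      right_inv := fun _ ↦ rfl }
end

section
/- Let 𝔽_q be a finite field with q elements and K a field extension of 𝔽_q. Let V be a finite-dimensional 𝔽_q-subspace of K with dim_{𝔽_q} V = s. Let F_1, …, F_m ∈ K[y_1, …, y_n] with total degrees deg F_t ≤ d_t, d_t ≥ 1 for each t, and let W_1, …, W_m be finite-dimensional 𝔽_q-subspaces of K with dim_{𝔽_q} W_t = r_t such that F_t(f_1, …, f_n) ∈ W_t whenever f_1, …, f_n ∈ V, for each t. Then for every natural number κ satisfying κ·(max_t d_t) ≤ s·n − Σ_{t=1}^m r_t·d_t (as integers), q^κ divides the cardinality of the set {(f_1, …, f_n) ∈ V^n : F_t(f_1, …, f_n) = 0 for all t = 1, …, m}. -/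
/-- `f` is annihilated by any `e` forward differences, i.e. `f` is an integer-valued polynomial map
of degree less than `e`. -/
def FwdDegLT {M : Type*} [AddCommMonoid M] : ℕ → (M → ℤ) → Prop
  | 0, f => ∀ x, f x = 0
  | e + 1, f => ∀ h, FwdDegLT e (fwdDiff h f)

namespace FwdDegLT

open Finset fwdDiff

variable {M : Type*} [AddCommMonoid M] {e e' : ℕ} {f g : M → ℤ}

theorem zero : FwdDegLT e (0 : M → ℤ) := by
  induction e with
  | zero => intro x; rfl
  | succ e ih =>
    intro h
    have : fwdDiff h (0 : M → ℤ) = 0 := fwdDiff_const h 0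
    rwa [this]

theorem succ (hf : FwdDegLT e f) : FwdDegLT (e + 1) f := by
  induction e generalizing f with
  | zero =>
    have : f = 0 := funext hf
    rw [this]
    exact zero
  | succ e ih => exact fun h => ih (hf h)

theorem mono (hf : FwdDegLT e f) (h : e ≤ e') : FwdDegLT e' f := by
  induction h with
  | refl => exact hf
  | step _ ih => exact ih.succ

theorem add (hf : FwdDegLT e f) (hg : FwdDegLT e g) : FwdDegLT e (f + g) := by
  induction e generalizing f g with
  | zero => intro x; simp [hf x, hg x]
  | succ e ih =>
    intro h
    rw [fwdDiff_add]
    exact ih (hf h) (hg h)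

theorem sum {α : Type*} (s : Finset α) {f : α → M → ℤ} (hf : ∀ a ∈ s, FwdDegLT e (f a)) :
    FwdDegLT e (∑ a ∈ s, f a) := by
  classical
  induction s using Finset.induction_on with
  | empty => exact zero
  | insert a s ha ih =>
    rw [sum_insert ha]
    exact (hf a (mem_insert_self a s)).add (ih fun b hb => hf b (mem_insert_of_mem hb))

theorem const (c : ℤ) : FwdDegLT 1 (fun _ : M => c) := by
  intro h x
  simp

theorem fwdDiff_iter (h : M) (hf : FwdDegLT e f) (k : ℕ) :
    FwdDegLT (e - k) ((fwdDiff h)^[k] f) := by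
  induction k with
  | zero => exact hf
  | succ k ih =>
    rw [Function.iterate_succ_apply']
    obtain h0 | ⟨j, hj⟩ : e - k = 0 ∨ ∃ j, e - k = j + 1 := by
      cases e - k <;> simp
    · have : e - (k + 1) = 0 := by omega
      rw [h0] at ih
      rw [this, show (fwdDiff h)^[k] f = 0 from funext ih]
      exact fun x => by simp [fwdDiff]
    · rw [hj] at ih
      rw [show e - (k + 1) = j by omega]
      exact ih h

/-- Degrees add under multiplication. -/
theorem mul {a b : ℕ} (hf : FwdDegLT (a + 1) f) (hg : FwdDegLT (b + 1) g) :
    FwdDegLT (a + b + 1) (f * g) := by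
  have zmul : ∀ {u v : M → ℤ} {e}, FwdDegLT 0 u → FwdDegLT e (u * v) := by
    intro u v e hu
    rw [show u = 0 from funext hu, zero_mul]
    exact zero
  induction hn : a + b using Nat.strong_induction_on generalizing a b f g with
  | _ n ih =>
    intro h
    have key : fwdDiff h (f * g) =
        fwdDiff h f * g + f * fwdDiff h g + fwdDiff h f * fwdDiff h g := fwdDiff_smul h f g
    rw [key]
    refine ((?_ : FwdDegLT n _).add ?_).add ?_
    · rcases a with _ | a
      · exact zmul (hf h)
      · exact (ih (a + b) (by omega) (hf h) hg rfl).mono (by omega)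
    · rcases b with _ | b
      · rw [mul_comm]; exact zmul (hg h)
      · exact (ih (a + b) (by omega) hf (hg h) rfl).mono (by omega)
    · rcases a with _ | a
      · exact zmul (hf h)
      · rcases b with _ | b
        · rw [mul_comm]; exact zmul (hg h)
        · exact (ih (a + b) (by omega) (hf h) (hg h) rfl).mono (by omega)

theorem prod {α : Type*} (s : Finset α) {f : α → M → ℤ} {d : α → ℕ}
    (hf : ∀ a ∈ s, FwdDegLT (d a + 1) (f a)) :
    FwdDegLT (∑ a ∈ s, d a + 1) (∏ a ∈ s, f a) := by
  classical
  induction s using Finset.induction_on with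
  | empty => exact const 1
  | insert a s ha ih =>
    rw [prod_insert ha, sum_insert ha]
    exact (hf a (mem_insert_self a s)).mul (ih fun b hb => hf b (mem_insert_of_mem hb))

theorem addMonoidHom (φ : M →+ ℤ) : FwdDegLT 2 (φ : M → ℤ) := by
  intro h
  have : fwdDiff h (φ : M → ℤ) = fun _ => φ h := by
    ext x; simp [fwdDiff]
  rw [this]
  exact const _

/-- Composing a map of degree at most `d` with the `k`-th binomial coefficient gives a map of degree
at most `k * d`. -/
theorem choose {d : ℕ} (hg : FwdDegLT (d + 1) g) (k : ℕ) :
    FwdDegLT (k * d + 1) (fun x => Ring.choose (g x) k) := by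
  induction d generalizing g k with
  | zero =>
    intro h x
    have : g (x + h) = g x := sub_eq_zero.mp (hg h x)
    simp [fwdDiff, this]
  | succ d ih =>
    induction k using Nat.strong_induction_on with
    | _ k ihk =>
      intro h
      have key : fwdDiff h (fun x => Ring.choose (g x) k) =
          ∑ i ∈ range k, (fun x => Ring.choose (g x) i) *
            fun x => Ring.choose (fwdDiff h g x) (k - i) := by
        ext x
        have hx : g (x + h) = g x + fwdDiff h g x := by simp [fwdDiff]
        simp only [Finset.sum_apply, Pi.mul_apply]
        rw [fwdDiff, hx, Ring.add_choose_eq k (Commute.all _ _),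
          Finset.Nat.sum_antidiagonal_eq_sum_range_succ_mk, sum_range_succ]
        simp
      rw [key]
      refine sum _ fun i hi => ?_
      rw [mem_range] at hi
      refine ((ihk i hi).mul (ih (hg h) (k - i))).mono ?_
      obtain ⟨j, rfl⟩ := Nat.exists_eq_add_of_lt hi
      rw [show i + j + 1 - i = j + 1 by omega]
      nlinarith

end FwdDegLT

open Finset in
/-- The sum of `f` along an arithmetic progression in terms of its forward differences. -/
theorem sum_range_shift_eq_sum_fwdDiff_iter {M : Type*} [AddCommMonoid M] (h : M) (f : M → ℤ)
    (n : ℕ) (x : M) :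
    ∑ i ∈ range n, f (x + i • h) =
      ∑ k ∈ range n, (n.choose (k + 1) : ℤ) * (fwdDiff h)^[k] f x := by
  induction n with
  | zero => simp
  | succ n ih =>
    rw [sum_range_succ, ih, shift_eq_sum_fwdDiff_iter h f n x]
    simp only [Nat.choose_succ_succ n, Nat.cast_add, add_mul, sum_add_distrib, nsmul_eq_mul]
    rw [add_comm, sum_range_succ (fun k => (n.choose (k + 1) : ℤ) * _)]
    simp

open Finset in
/-- The sum of a map of degree less than `c * (p - 1)` over an `N`-dimensional box with sides of
length `p` is highly divisible by `p`. -/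
theorem FwdDegLT.pow_dvd_sum_box {M : Type*} [AddCommMonoid M] {p : ℕ} (hp : p.Prime) {N : ℕ}
    (h : Fin N → M) {f : M → ℤ} {c κ : ℕ} (hf : FwdDegLT (c * (p - 1)) f) (hκ : κ + c ≤ N + 1) :
    (p : ℤ) ^ κ ∣ ∑ a : Fin N → Fin p, f (∑ j, (a j : ℕ) • h j) := by
  induction N generalizing f c κ with
  | zero =>
    rcases c with _ | c
    · rw [zero_mul] at hf
      simp [hf _]
    · simp [show κ = 0 by omega]
  | succ N ih =>
    rcases c with _ | c
    · rw [zero_mul] at hf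
      simp [hf _]
    rcases κ with _ | κ
    · simp
    obtain ⟨r, hr⟩ : ∃ r, p = r + 1 := ⟨p - 1, by have := hp.pos; omega⟩
    have hsum : ∑ a : Fin (N + 1) → Fin p, f (∑ j, (a j : ℕ) • h j) =
        ∑ a : Fin N → Fin p, ∑ i ∈ range p, f (∑ j, (a j : ℕ) • h j.succ + i • h 0) := by
      rw [← (Fin.consEquiv fun _ => Fin p).sum_comp, Fintype.sum_prod_type, sum_comm]
      refine sum_congr rfl fun a _ => ?_
      rw [← Fin.sum_univ_eq_sum_range (fun i => f (∑ j, (a j : ℕ) • h j.succ + i • h 0))]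
      refine sum_congr rfl fun i _ => ?_
      rw [Fin.sum_univ_succ]
      simp [Fin.consEquiv, add_comm]
    have hsplit : ∀ x, ∑ i ∈ range p, f (x + i • h 0) =
        p * (∑ k ∈ range (p - 1), ((p.choose (k + 1) / p : ℕ) : ℤ) • (fwdDiff (h 0))^[k] f) x
          + (fwdDiff (h 0))^[p - 1] f x := by
      intro x
      rw [sum_range_shift_eq_sum_fwdDiff_iter]
      conv_lhs => rw [show p = p - 1 + 1 by omega, sum_range_succ]
      rw [show p - 1 + 1 = p by omega]
      simp only [Finset.sum_apply, Pi.smul_apply, mul_sum, smul_eq_mul, ← mul_assoc]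
      congr 1
      · refine sum_congr rfl fun k hk => ?_
        rw [mem_range] at hk
        congr 1
        exact_mod_cast (Nat.mul_div_cancel' (hp.dvd_choose_self (by omega) (by omega))).symm
      · simp
    rw [hsum]
    simp only [hsplit, sum_add_distrib, ← mul_sum]
    refine dvd_add ?_ ?_
    · rw [pow_succ']
      refine mul_dvd_mul_left _ (ih _ (c := c + 1) ?_ (by omega))
      refine FwdDegLT.sum _ fun k _ => ?_
      have h1 := (FwdDegLT.const (M := M) ((p.choose (k + 1) / p : ℕ) : ℤ))
      have h2 := (hf.fwdDiff_iter (h 0) k).mono (Nat.sub_le _ _)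
      have h3 : (c + 1) * (p - 1) = (c + 1) * (p - 1) - 1 + 1 := by
        have := hp.two_le
        have : 0 < (c + 1) * (p - 1) := Nat.mul_pos (by omega) (by omega)
        omega
      rw [h3] at h2 ⊢
      have h4 := h1.mul (a := 0) h2
      rwa [zero_add] at h4
    · refine ih _ (c := c) ?_ (by omega)
      have := hf.fwdDiff_iter (h 0) (p - 1)
      rwa [add_mul, one_mul, Nat.add_sub_cancel] at this

theorem Function.Periodic.fwdDiff_iter {p : ℕ} {f : ℕ → ℤ} (hf : Function.Periodic f p) (k : ℕ) :
    Function.Periodic ((fwdDiff 1)^[k] f) p := by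
  induction k with
  | zero => exact hf
  | succ k ih =>
    intro x
    rw [Function.iterate_succ_apply', fwdDiff, fwdDiff, ih, add_right_comm, ih]

open Finset in
theorem pow_dvd_fwdDiff_iter_mul_add_one_of_periodic {p : ℕ} (hp : p.Prime) (v : ℕ) {f : ℕ → ℤ}
    (hf : Function.Periodic f p) (x : ℕ) : (p : ℤ) ^ v ∣ (fwdDiff 1)^[v * (p - 1) + 1] f x := by
  induction v generalizing f with
  | zero => simp
  | succ v ih =>
    have hp2 := hp.two_le
    set g : ℕ → ℤ :=
      ∑ k ∈ range (p - 1), (-(p.choose (k + 1) / p : ℕ) : ℤ) • (fwdDiff 1)^[k] f with hg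
    have hgper : Function.Periodic g p := by
      intro x
      simp only [hg, Finset.sum_apply, Pi.smul_apply]
      exact sum_congr rfl fun k _ => by rw [hf.fwdDiff_iter k]
    have key : (fwdDiff 1)^[p] f = (p : ℤ) • fwdDiff 1 g := by
      have h1 : fwdDiff 1 g = ∑ k ∈ range (p - 1),
          (-(p.choose (k + 1) / p : ℕ) : ℤ) • (fwdDiff 1)^[k + 1] f := by
        simp only [hg, fwdDiff_finsetSum, fwdDiff_const_smul, Function.iterate_succ_apply']
      ext y
      have h2 := shift_eq_sum_fwdDiff_iter 1 f p y
      rw [smul_eq_mul, mul_one, hf y, sum_range_succ', show p = p - 1 + 1 by omega,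
        sum_range_succ, show p - 1 + 1 = p by omega] at h2
      simp only [Nat.choose_self, Nat.choose_zero_right, one_smul, Function.iterate_zero, id,
        nsmul_eq_mul] at h2
      rw [h1]
      simp only [Finset.sum_apply, Pi.smul_apply, smul_eq_mul, mul_sum]
      have h3 : ∀ k ∈ range (p - 1), (p : ℤ) * (-(p.choose (k + 1) / p : ℕ) *
          (fwdDiff 1)^[k + 1] f y) = -((p.choose (k + 1) : ℤ) * (fwdDiff 1)^[k + 1] f y) := by
        intro k hk
        rw [mem_range] at hk
        have : (p : ℤ) * (p.choose (k + 1) / p : ℕ) = p.choose (k + 1) := by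
          exact_mod_cast Nat.mul_div_cancel' (hp.dvd_choose_self (by omega) (by omega))
        rw [← this]
        ring
      rw [sum_congr rfl h3, sum_neg_distrib]
      linarith
    rw [show (v + 1) * (p - 1) + 1 = v * (p - 1) + p by rw [add_mul]; omega,
      Function.iterate_add_apply, key, fwdDiff_iter_const_smul, ← Function.iterate_succ_apply,
      Pi.smul_apply, smul_eq_mul, pow_succ']
    exact mul_dvd_mul_left _ (ih hgper)

theorem pow_dvd_fwdDiff_iter_of_periodic {p : ℕ} (hp : p.Prime) (k : ℕ) {f : ℕ → ℤ}
    (hf : Function.Periodic f p) (x : ℕ) :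
    (p : ℤ) ^ ((k - 1) / (p - 1)) ∣ (fwdDiff 1)^[k] f x := by
  rcases k with _ | k
  · simp
  have hk : k + 1 = (k / (p - 1) * (p - 1) + 1) + k % (p - 1) := by
    have := Nat.div_add_mod' k (p - 1)
    omega
  rw [Nat.add_sub_cancel, hk, Function.iterate_add_apply]
  exact pow_dvd_fwdDiff_iter_mul_add_one_of_periodic hp _ (hf.fwdDiff_iter _) x

open Finset in
/-- The Ax–Katz estimate over a prime field, for integer-valued polynomial maps on a box. -/
theorem pow_dvd_card_box_filter_dvd {p : ℕ} (hp : p.Prime) {N : ℕ} {ι : Type*} [Fintype ι]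
    (g : ι → (Fin N → ℕ) → ℕ) (d : ι → ℕ)
    (hg : ∀ i, FwdDegLT (d i + 1) (fun x => (g i x : ℤ))) {D κ : ℕ} (hD : 1 ≤ D)
    (hdD : ∀ i, d i ≤ D) (hκ : κ * D + ∑ i, d i ≤ N) :
    p ^ κ ∣ #{a : Fin N → Fin p | ∀ i, p ∣ g i (fun j => a j)} := by
  classical
  have hp2 := hp.two_le
  let δ : ℕ → ℤ := fun y => if p ∣ y then 1 else 0
  have hδ : Function.Periodic δ p := fun y => by simp [δ]
  let val : (Fin N → Fin p) → Fin N → ℕ := fun a j => a j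
  let c : ℕ → ℤ := fun k => (fwdDiff 1)^[k] δ 0
  have hc : ∀ k, (p : ℤ) ^ ((k - 1) / (p - 1)) ∣ c k :=
    fun k => pow_dvd_fwdDiff_iter_of_periodic hp k hδ 0
  obtain ⟨Y, hY⟩ : ∃ Y, ∀ i a, g i (val a) < Y := by
    refine ⟨(univ : Finset (ι × (Fin N → Fin p))).sup (fun x => g x.1 (val x.2)) + 1,
      fun i a => Nat.lt_succ_of_le ?_⟩
    exact le_sup (f := fun x : ι × (Fin N → Fin p) => g x.1 (val x.2)) (mem_univ (i, a))
  have hnewton : ∀ y < Y, δ y = ∑ k ∈ range Y, c k * Ring.choose (y : ℤ) k := by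
    intro y hy
    have h := shift_eq_sum_fwdDiff_iter 1 δ y 0
    rw [zero_add, smul_eq_mul, mul_one] at h
    rw [h]
    refine (sum_subset (range_mono hy) fun k _ hk => ?_).trans (sum_congr rfl fun k _ => ?_)
    · rw [mem_range, not_lt] at hk
      rw [Nat.choose_eq_zero_of_lt hk, zero_smul]
    · rw [Ring.choose_natCast, nsmul_eq_mul, mul_comm]
  have hcard : ((#{a : Fin N → Fin p | ∀ i, p ∣ g i (val a)} : ℕ) : ℤ) =
      ∑ k ∈ Fintype.piFinset fun _ : ι => range Y, (∏ i, c (k i)) *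
        ∑ a : Fin N → Fin p, ∏ i, Ring.choose (g i (val a) : ℤ) (k i) := by
    rw [card_filter]
    push_cast
    simp only [mul_sum]
    rw [sum_comm]
    refine sum_congr rfl fun a _ => ?_
    simp only [← prod_mul_distrib]
    rw [← prod_univ_sum (fun _ => range Y) fun i k => c k * Ring.choose (g i (val a) : ℤ) k]
    rw [← prod_congr rfl fun i _ => hnewton _ (hY i a)]
    simp only [δ]
    rw [Fintype.prod_ite_zero]
    simp
  have hmain : (p : ℤ) ^ κ ∣ (#{a : Fin N → Fin p | ∀ i, p ∣ g i (val a)} : ℕ) := by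
    rw [hcard]
    refine dvd_sum fun k _ => ?_
    set v := ∑ i, (k i - 1) / (p - 1) with hv
    have hdvd : (p : ℤ) ^ v ∣ ∏ i, c (k i) := by
      rw [hv, ← prod_pow_eq_pow_sum]
      exact prod_dvd_prod_of_dvd _ _ fun i _ => hc _
    rcases le_or_gt κ v with hle | hlt
    · exact ((pow_dvd_pow _ hle).trans hdvd).mul_right _
    have hdeg : FwdDegLT ((∑ i, d i + D * v + 1) * (p - 1))
        (∏ i, fun x => Ring.choose (g i x : ℤ) (k i)) := by
      refine (FwdDegLT.prod univ fun i _ => (hg i).choose (k i)).mono ?_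
      have h1 : ∑ i, k i * d i ≤ (∑ i, d i + D * v) * (p - 1) := by
        rw [hv, mul_sum, ← sum_add_distrib, sum_mul]
        refine sum_le_sum fun i _ => ?_
        have h2 : k i ≤ (1 + (k i - 1) / (p - 1)) * (p - 1) := by
          have := Nat.lt_div_mul_add (a := k i - 1) (b := p - 1) (by omega)
          rw [add_mul]
          omega
        calc k i * d i ≤ (1 + (k i - 1) / (p - 1)) * (p - 1) * d i := Nat.mul_le_mul_right _ h2
          _ = (d i + d i * ((k i - 1) / (p - 1))) * (p - 1) := by ring
          _ ≤ _ := by gcongr; exact hdD i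
      rw [add_mul _ 1]
      omega
    obtain ⟨u, rfl⟩ := Nat.exists_eq_add_of_lt hlt
    have hbox := hdeg.pow_dvd_sum_box hp (fun j => Pi.single j 1) (κ := u + 1) (by nlinarith)
    have hval : ∀ a : Fin N → Fin p,
        ∑ j, (a j : ℕ) • (Pi.single j 1 : Fin N → ℕ) = val a := by
      intro a
      ext j
      simp [val, Finset.sum_apply, Pi.single_apply]
    simp only [hval, Finset.prod_apply] at hbox
    rw [add_assoc, pow_add]
    exact mul_dvd_mul hdvd hbox
  exact_mod_cast hmain

theorem MvPolynomial.totalDegree_bind₁_le {σ τ R : Type*} [CommSemiring R]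
    (G : σ → MvPolynomial τ R) (hG : ∀ j, (G j).totalDegree ≤ 1) (F : MvPolynomial σ R) :
    (bind₁ G F).totalDegree ≤ F.totalDegree := by
  rw [F.as_sum, map_sum, ← F.as_sum]
  refine (totalDegree_finsetSum_le fun m hm => ?_)
  rw [bind₁_monomial]
  refine (totalDegree_mul _ _).trans ?_
  rw [totalDegree_C, zero_add]
  refine (totalDegree_finsetProd _ _).trans (le_trans ?_ (le_totalDegree hm))
  refine Finset.sum_le_sum fun j _ => (totalDegree_pow _ _).trans ?_
  simpa using Nat.mul_le_mul_left (m j) (hG j)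

open Finset in
/-- A linear functional of the values of a polynomial at the points of the prime field lifts to an
integer-valued polynomial map of the same degree. -/
theorem exists_fwdDegLT_lift {p : ℕ} [Fact p.Prime] {K : Type*} [Field K] [Algebra (ZMod p) K]
    {N : ℕ} (P : MvPolynomial (Fin N) K) (φ : K →ₗ[ZMod p] ZMod p) :
    ∃ g : (Fin N → ℕ) → ℕ, FwdDegLT (P.totalDegree + 1) (fun x => (g x : ℤ)) ∧
      ∀ x, (g x : ZMod p) = φ (MvPolynomial.eval (fun j => (x j : K)) P) := by
  refine ⟨fun x => ∑ m ∈ P.support, (φ (P.coeff m)).val * ∏ j, x j ^ m j, ?_, fun x => ?_⟩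
  · have : (fun x : Fin N → ℕ =>
        ((∑ m ∈ P.support, (φ (P.coeff m)).val * ∏ j, x j ^ m j : ℕ) : ℤ)) =
        ∑ m ∈ P.support, (fun _ => ((φ (P.coeff m)).val : ℤ)) *
          ∏ j, ∏ _i ∈ range (m j), fun x => (x j : ℤ) := by
      ext x
      simp [Finset.sum_apply, Finset.prod_apply]
    rw [this]
    refine FwdDegLT.sum _ fun m hm => ?_
    have hlin : ∀ j : Fin N, FwdDegLT (1 + 1) (fun x : Fin N → ℕ => (x j : ℤ)) := fun j =>
      FwdDegLT.addMonoidHom ((Nat.castAddMonoidHom ℤ).comp (Pi.evalAddMonoidHom (fun _ => ℕ) j))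
    refine ((FwdDegLT.const _).mul (a := 0) (FwdDegLT.prod univ (d := fun j => m j)
      fun j _ => ?_)).mono ?_
    · simpa using FwdDegLT.prod (range (m j)) (d := fun _ => 1) fun _ _ => hlin j
    · have := MvPolynomial.le_totalDegree hm
      rw [Finsupp.sum_fintype _ _ fun _ => rfl] at this
      omega
  · rw [MvPolynomial.eval_eq', map_sum]
    push_cast
    refine sum_congr rfl fun m _ => ?_
    have : P.coeff m * ∏ j, (x j : K) ^ m j =
        (∏ j, (x j : ZMod p) ^ m j) • P.coeff m := by
      rw [Algebra.smul_def, map_prod, mul_comm]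
      simp
    rw [this, map_smul, smul_eq_mul, mul_comm, ZMod.natCast_zmod_val]

open Finset in
/-- The Ax–Katz estimate for polynomial maps between subspaces of an extension of a prime field. -/
theorem pow_dvd_card_zeros_of_zmod {p : ℕ} [Fact p.Prime] {K : Type*} [Field K]
    [Algebra (ZMod p) K] (V : Submodule (ZMod p) K) [FiniteDimensional (ZMod p) V] {n : ℕ}
    {τ : Type*} [Fintype τ] (F : τ → MvPolynomial (Fin n) K) (d : τ → ℕ)
    (hFd : ∀ t, (F t).totalDegree ≤ d t) (W : τ → Submodule (ZMod p) K)
    [∀ t, FiniteDimensional (ZMod p) (W t)]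
    (hFW : ∀ t, ∀ f : Fin n → K, (∀ j, f j ∈ V) → MvPolynomial.eval f (F t) ∈ W t)
    {D κ : ℕ} (hD : 1 ≤ D) (hdD : ∀ t, d t ≤ D)
    (hκ : κ * D + ∑ t, Module.finrank (ZMod p) (W t) * d t ≤ Module.finrank (ZMod p) V * n) :
    p ^ κ ∣ Nat.card
      {f : Fin n → K // (∀ j, f j ∈ V) ∧ ∀ t, MvPolynomial.eval f (F t) = 0} := by
  classical
  have hp : p.Prime := Fact.out
  set N := Module.finrank (ZMod p) (Fin n → V) with hN
  have hNn : N = Module.finrank (ZMod p) V * n := by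
    rw [hN, Module.finrank_pi_fintype]
    simp [mul_comm]
  let b : Module.Basis (Fin N) (ZMod p) (Fin n → V) := Module.finBasis _ _
  let P : τ → MvPolynomial (Fin N) K := fun t =>
    MvPolynomial.bind₁ (fun j => ∑ l, MvPolynomial.C (b l j : K) * MvPolynomial.X l) (F t)
  have hP : ∀ t, (P t).totalDegree ≤ d t := by
    refine fun t => (MvPolynomial.totalDegree_bind₁_le _ (fun j => ?_) _).trans (hFd t)
    refine MvPolynomial.totalDegree_finsetSum_le fun l _ => ?_
    refine (MvPolynomial.totalDegree_mul _ _).trans ?_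
    simp
  have hPeval : ∀ t (a : Fin N → ZMod p), MvPolynomial.eval (fun l => algebraMap (ZMod p) K (a l))
      (P t) = MvPolynomial.eval (fun j => ((∑ l, a l • b l) j : K)) (F t) := by
    intro t a
    rw [← MvPolynomial.coe_aeval_eq_eval, ← MvPolynomial.coe_aeval_eq_eval]
    simp only [RingHom.coe_coe, P, MvPolynomial.aeval_bind₁]
    congr 2
    ext j
    simp [Finset.sum_apply, Algebra.smul_def, mul_comm]
  have hφ : ∀ t, ∃ φ : Fin (Module.finrank (ZMod p) (W t)) → (K →ₗ[ZMod p] ZMod p),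
      ∀ w ∈ W t, w = 0 ↔ ∀ i, φ i w = 0 := by
    intro t
    let B := Module.finBasis (ZMod p) (W t)
    choose φ hφ using fun i => (B.coord i).exists_extend
    refine ⟨φ, fun w hw => ?_⟩
    have : ∀ i, φ i w = B.coord i ⟨w, hw⟩ := fun i => by rw [← hφ i]; rfl
    simp only [this, B.forall_coord_eq_zero_iff]
    simp
  choose φ hφ using hφ
  choose g hg hgφ using fun i : Σ t, Fin (Module.finrank (ZMod p) (W t)) =>
    exists_fwdDegLT_lift (P i.1) (φ i.1 i.2)
  have hbox := pow_dvd_card_box_filter_dvd hp g (fun i => d i.1)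
    (fun i => (hg i).mono (by have := hP i.1; omega)) hD (fun i => hdD i.1) (κ := κ) (by
      rw [hNn, Fintype.sum_sigma]
      simpa using hκ)
  rw [← Fintype.card_subtype, ← Nat.card_eq_fintype_card] at hbox
  convert hbox using 1
  refine Nat.card_congr (Equiv.symm ?_)
  let e₁ : (Fin N → Fin p) ≃ (Fin n → V) :=
    (Equiv.piCongrRight fun _ => (ZMod.finEquiv p).toEquiv).trans b.equivFun.symm.toEquiv
  let e₂ : {f : Fin n → V // ∀ t, MvPolynomial.eval (fun j => (f j : K)) (F t) = 0} ≃
      {f : Fin n → K // (∀ j, f j ∈ V) ∧ ∀ t, MvPolynomial.eval f (F t) = 0} :=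
    { toFun := fun f => ⟨fun j => f.1 j, fun j => (f.1 j).2, f.2⟩
      invFun := fun f => ⟨fun j => ⟨f.1 j, f.2.1 j⟩, f.2.2⟩
      left_inv := fun _ => rfl
      right_inv := fun _ => rfl }
  refine (e₁.subtypeEquiv fun a => ?_).trans e₂
  have hcast : ∀ i : Fin p, ((i : ℕ) : ZMod p) = ZMod.finEquiv p i := by
    intro i
    obtain ⟨r, rfl⟩ : ∃ r, p = r + 1 := ⟨p - 1, by have := hp.pos; omega⟩
    exact Fin.cast_val_eq_self i
  have he₁ : e₁ a = ∑ l, ((a l : ℕ) : ZMod p) • b l := by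
    simp only [hcast]
    exact b.equivFun_symm_apply _
  rw [Sigma.forall]
  refine forall_congr' fun t => ?_
  rw [hφ t _ (hFW t _ fun j => (e₁ a j).2)]
  refine forall_congr' fun i => ?_
  rw [← ZMod.natCast_eq_zero_iff, hgφ, he₁, ← hPeval]
  simp


/-- Several-polynomial Ax–Katz-type divisibility estimate: with `V` of
dimension `s` and each `F_t` of degree at most `d_t ≥ 1` mapping `Vⁿ` into a
subspace `W_t` of dimension `r_t`, for every `κ` with
`κ·(max_t d_t) ≤ s·n − ∑_t r_t·d_t` the power `q^κ` divides the number of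
common solutions of `F_1 = ⋯ = F_m = 0` with coordinates in `V`. -/
theorem ax_katz_riemann_roch_divisibility_several
    {𝔽 K : Type*} [Field 𝔽] [Fintype 𝔽] [Field K] [Algebra 𝔽 K]
    (q : ℕ) (hq : Fintype.card 𝔽 = q)
    (V : Submodule 𝔽 K) [FiniteDimensional 𝔽 V]
    (s n m : ℕ) (hm : 0 < m)
    (hs : Module.finrank 𝔽 V = s)
    (F : Fin m → MvPolynomial (Fin n) K) (d : Fin m → ℕ)
    (hd : ∀ t, 1 ≤ d t) (hFd : ∀ t, (F t).totalDegree ≤ d t)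
    (W : Fin m → Submodule 𝔽 K) (hWfin : ∀ t, FiniteDimensional 𝔽 (W t))
    (r : Fin m → ℕ) (hr : ∀ t, Module.finrank 𝔽 (W t) = r t)
    (hFW : ∀ t, ∀ f : Fin n → K, (∀ j, f j ∈ V) → MvPolynomial.eval f (F t) ∈ W t) :
    ∀ κ : ℕ, (κ : ℤ) * ((Finset.univ.sup d : ℕ) : ℤ) ≤ (s : ℤ) * n - ∑ t, (r t : ℤ) * (d t : ℤ) →
      q ^ κ ∣ Nat.card
        {f : Fin n → K // (∀ j, f j ∈ V) ∧ ∀ t, MvPolynomial.eval f (F t) = 0} := by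
  intro κ hκ
  obtain ⟨p, hchar⟩ := CharP.exists 𝔽
  have hp : Fact p.Prime := ⟨CharP.char_is_prime 𝔽 p⟩
  let : Algebra (ZMod p) 𝔽 := ZMod.algebra 𝔽 p
  let : Algebra (ZMod p) K := ((algebraMap 𝔽 K).comp (algebraMap (ZMod p) 𝔽)).toAlgebra
  have : IsScalarTower (ZMod p) 𝔽 K := IsScalarTower.of_algebraMap_eq fun _ => rfl
  set e := Module.finrank (ZMod p) 𝔽 with he
  have hqe : q = p ^ e := by
    rw [← hq, Module.card_eq_pow_finrank (K := ZMod p), ZMod.card]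
  have hrank : ∀ U : Submodule 𝔽 K,
      Module.finrank (ZMod p) (U.restrictScalars (ZMod p)) = e * Module.finrank 𝔽 U :=
    fun U => (Module.finrank_mul_finrank (ZMod p) 𝔽 U).symm
  have hfin : ∀ U : Submodule 𝔽 K, FiniteDimensional 𝔽 U →
      FiniteDimensional (ZMod p) (U.restrictScalars (ZMod p)) :=
    fun U _ => Module.Finite.trans (R := ZMod p) 𝔽 U
  have := hfin V inferInstance
  have : ∀ t, FiniteDimensional (ZMod p) ((W t).restrictScalars (ZMod p)) :=
    fun t => hfin (W t) (hWfin t)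
  have hdD : ∀ t, d t ≤ Finset.univ.sup d := fun t => Finset.le_sup (Finset.mem_univ t)
  have hκ' : κ * Finset.univ.sup d + ∑ t, r t * d t ≤ s * n := by
    zify
    linarith
  rw [hqe, ← pow_mul]
  refine pow_dvd_card_zeros_of_zmod (V.restrictScalars (ZMod p)) F d hFd
    (fun t => (W t).restrictScalars (ZMod p)) hFW ((hd ⟨0, hm⟩).trans (hdD _)) hdD ?_
  simp only [hrank, hs, hr]
  calc e * κ * Finset.univ.sup d + ∑ t, e * r t * d t
      = e * (κ * Finset.univ.sup d + ∑ t, r t * d t) := by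
        rw [mul_add, Finset.mul_sum, mul_assoc]
        simp only [mul_assoc]
    _ ≤ e * (s * n) := Nat.mul_le_mul_left _ hκ'
    _ = e * s * n := (mul_assoc _ _ _).symm
end

section
/- Let p be a prime, q a power of p, 𝔽_q the finite field with q elements, and K a field extension of 𝔽_q. Let M be an additive commutative monoid equipped with an additive monoid homomorphism deg : M → ℕ such that for every k ∈ ℕ the set {E ∈ M : deg E = k} is finite. Let n ≥ 1, d ≥ 1, and let F ∈ K[y_1, …, y_n] be a polynomial of total degree at most d. Suppose that to each E ∈ M are associated finite-dimensional 𝔽_q-subspaces L(E) and W(E) of K such that: (i) F(f_1, …, f_n) ∈ W(E) whenever f_1, …, f_n ∈ L(E); and (ii) there exist real constants c > 0 and C and an integer m ≥ 2 with n·dim_{𝔽_q} L(E) − d·dim_{𝔽_q} W(E) ≥ c·(deg E)^m − C·(deg E)^{m−1} for all E ∈ M. For each k ∈ ℕ set M_k := Σ_{E ∈ M, deg E = k} #{(f_1, …, f_n) ∈ L(E)^n : F(f_1, …, f_n) = 0}. Then the power series Σ_{k ≥ 0} M_k T^k with coefficients viewed in ℚ_p is p-adic entire: for every x ∈ ℚ_p,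 the series Σ_{k ≥ 0} M_k x^k converges in ℚ_p. -/
open scoped fwdDiff

/-- `FwdDegreeLT n f` says that all `n`-fold forward differences of `f` vanish, i.e. that `f` has
functional degree less than `n`. -/
def FwdDegreeLT {A : Type*} [AddCommMonoid A] : ℕ → (A → ℤ) → Prop
  | 0, f => f = 0
  | n + 1, f => ∀ h, FwdDegreeLT n (Δ_[h] f)

namespace FwdDegreeLT

variable {A : Type*} [AddCommMonoid A]

lemma zero (n : ℕ) : FwdDegreeLT n (0 : A → ℤ) := by
  induction n with
  | zero => rfl
  | succ n ih =>
    intro h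
    have : Δ_[h] (0 : A → ℤ) = 0 := by ext; simp [fwdDiff]
    rwa [this]

lemma succ {n : ℕ} {f : A → ℤ} (hf : FwdDegreeLT n f) : FwdDegreeLT (n + 1) f := by
  induction n generalizing f with
  | zero =>
    have hf : f = 0 := hf
    exact hf ▸ zero 1
  | succ n ih => exact fun h ↦ ih (hf h)

lemma mono {m n : ℕ} (hmn : m ≤ n) {f : A → ℤ} (hf : FwdDegreeLT m f) : FwdDegreeLT n f := by
  induction hmn with
  | refl => exact hf
  | step _ ih => exact ih.succ

lemma add {n : ℕ} {f g : A → ℤ} (hf : FwdDegreeLT n f) (hg : FwdDegreeLT n g) :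
    FwdDegreeLT n (f + g) := by
  induction n generalizing f g with
  | zero =>
    have hf : f = 0 := hf
    have hg : g = 0 := hg
    subst hf hg
    exact add_zero _
  | succ n ih =>
    intro h
    rw [fwdDiff_add]
    exact ih (hf h) (hg h)

lemma smul {n : ℕ} {f : A → ℤ} (c : ℤ) (hf : FwdDegreeLT n f) : FwdDegreeLT n (c • f) := by
  induction n generalizing f with
  | zero =>
    have hf : f = 0 := hf
    subst hf
    exact smul_zero _
  | succ n ih =>
    intro h
    rw [fwdDiff_const_smul]
    exact ih (hf h)

lemma of_smul {n : ℕ} {f : A → ℤ} {c : ℤ} (hc : c ≠ 0) (hf : FwdDegreeLT n (c • f)) :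
    FwdDegreeLT n f := by
  induction n generalizing f with
  | zero => exact (smul_eq_zero_iff_right hc).mp hf
  | succ n ih =>
    intro h
    have := hf h
    rw [fwdDiff_const_smul] at this
    exact ih this

lemma sum {ι : Type*} {n : ℕ} (s : Finset ι) {f : ι → A → ℤ}
    (hf : ∀ i ∈ s, FwdDegreeLT n (f i)) : FwdDegreeLT n (∑ i ∈ s, f i) :=
  Finset.sum_induction _ _ (fun _ _ ↦ add) (zero n) hf

lemma const (c : ℤ) : FwdDegreeLT 1 (fun _ : A ↦ c) := by
  intro h
  rw [fwdDiff_const]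
  rfl

lemma iterate {m n : ℕ} (h : A) {f : A → ℤ} (hf : FwdDegreeLT (m + n) f) :
    FwdDegreeLT m (Δ_[h] ^[n] f) := by
  induction n generalizing f with
  | zero => exact hf
  | succ n ih => exact ih (hf h)

lemma mul {m n : ℕ} {f g : A → ℤ} (hf : FwdDegreeLT m f) (hg : FwdDegreeLT n g) :
    FwdDegreeLT (m + n - 1) (f * g) := by
  induction hs : m + n generalizing m n f g with
  | zero =>
    obtain rfl : m = 0 := by omega
    have hf : f = 0 := hf
    subst hf
    rw [zero_mul]
    exact zero _
  | succ s ih =>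
    rcases m with _ | m
    · have hf : f = 0 := hf
      subst hf
      rw [zero_mul]
      exact zero _
    rcases n with _ | n
    · have hg : g = 0 := hg
      subst hg
      rw [mul_zero]
      exact zero _
    obtain ⟨t, rfl⟩ : ∃ t, s = t + 1 := ⟨s - 1, by omega⟩
    intro h
    have key := fwdDiff_smul h f g
    simp only [smul_eq_mul] at key
    rw [key]
    refine ((ih (hf h) hg (by omega)).add (ih hf (hg h) (by omega))).add ?_
    exact mono (by omega) (ih (hf h) (hg h).succ (by omega))

lemma prod {ι : Type*} (s : Finset ι) {f : ι → A → ℤ} {n : ι → ℕ}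
    (hf : ∀ i ∈ s, FwdDegreeLT (n i + 1) (f i)) :
    FwdDegreeLT ((∑ i ∈ s, n i) + 1) (∏ i ∈ s, f i) := by
  classical
  induction s using Finset.induction_on with
  | empty => exact const 1
  | insert i s hi ih =>
    rw [Finset.sum_insert hi, Finset.prod_insert hi]
    refine mono (by omega) ((hf i (Finset.mem_insert_self i s)).mul
      (ih fun j hj ↦ hf j (Finset.mem_insert_of_mem hj)))

lemma pow {n : ℕ} {f : A → ℤ} (hf : FwdDegreeLT (n + 1) f) (k : ℕ) :
    FwdDegreeLT (k * n + 1) (f ^ k) := by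
  simpa using prod (Finset.range k) (f := fun _ ↦ f) (n := fun _ ↦ n) fun _ _ ↦ hf

lemma of_additive {f : A → ℤ} (hf : ∀ x y, f (x + y) = f x + f y) : FwdDegreeLT 2 f := by
  intro h
  have : Δ_[h] f = fun _ ↦ f h := by
    ext x
    simp [fwdDiff, hf]
  rw [this]
  exact const _

lemma descFactorial {n : ℕ} {G : A → ℕ} (hG : FwdDegreeLT (n + 1) fun x ↦ (G x : ℤ)) (k : ℕ) :
    FwdDegreeLT (n * k + 1) fun x ↦ ((G x).descFactorial k : ℤ) := by
  induction k with
  | zero => simpa using const (A := A) 1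
  | succ k ih =>
    have h1 : FwdDegreeLT (n + 1) ((fun x ↦ (G x : ℤ)) + fun _ ↦ -(k : ℤ)) :=
      hG.add ((const _).mono (by omega))
    have h2 : (fun x ↦ ((G x).descFactorial (k + 1) : ℤ)) =
        ((fun x ↦ (G x : ℤ)) + fun _ ↦ -(k : ℤ)) * fun x ↦ ((G x).descFactorial k : ℤ) := by
      ext x
      simp only [Pi.mul_apply, Pi.add_apply, Nat.descFactorial_succ]
      rcases le_or_gt k (G x) with h | h
      · push_cast [h]
        ring
      · simp [Nat.descFactorial_of_lt h]
    rw [h2]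
    exact mono (by rw [Nat.mul_succ]; omega) (h1.mul ih)

lemma choose {n : ℕ} {G : A → ℕ} (hG : FwdDegreeLT (n + 1) fun x ↦ (G x : ℤ)) (k : ℕ) :
    FwdDegreeLT (n * k + 1) fun x ↦ ((G x).choose k : ℤ) := by
  refine of_smul (c := (k.factorial : ℤ)) (by exact_mod_cast k.factorial_ne_zero) ?_
  convert hG.descFactorial k using 1
  ext x
  simp [Nat.descFactorial_eq_factorial_mul_choose]

end FwdDegreeLT

lemma sum_range_shift_eq_sum_fwdDiff_iter_s7 {A G : Type*} [AddCommMonoid A] [AddCommGroup G]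
    (f : A → G) (h y : A) (n : ℕ) :
    ∑ j ∈ Finset.range n, f (y + j • h) =
      ∑ k ∈ Finset.range n, n.choose (k + 1) • Δ_[h] ^[k] f y := by
  have h1 : ∀ j ∈ Finset.range n, f (y + j • h) =
      ∑ k ∈ Finset.range n, j.choose k • Δ_[h] ^[k] f y := by
    intro j hj
    rw [shift_eq_sum_fwdDiff_iter h f j y]
    refine Finset.sum_subset ?_ fun k _ hk ↦ ?_
    · simpa using hj
    · rw [Nat.choose_eq_zero_of_lt (by simpa using hk), zero_smul]
  rw [Finset.sum_congr rfl h1, Finset.sum_comm]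
  refine Finset.sum_congr rfl fun k hk ↦ ?_
  rw [← Finset.sum_smul]
  congr 1
  rcases n with _ | n
  · simp at hk
  rw [← Nat.sum_Icc_choose]
  refine (Finset.sum_subset (fun i ↦ ?_) fun i _ hi ↦ ?_).symm
  · simp only [Finset.mem_Icc, Finset.mem_range]; omega
  · refine Nat.choose_eq_zero_of_lt ?_
    simp_all only [Finset.mem_Icc, Finset.mem_range]
    omega

variable {p : ℕ} [Fact p.Prime]

lemma FwdDegreeLT.exists_sum_shift_eq {A : Type*} [AddCommMonoid A] {f : A → ℤ} {D E : ℕ} (h : A)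
    (hD : FwdDegreeLT D f) (hE : D ≤ E + (p - 1)) :
    ∃ g r : A → ℤ, FwdDegreeLT D g ∧ FwdDegreeLT E r ∧
      ∀ y, ∑ j ∈ Finset.range p, f (y + j • h) = p * g y + r y := by
  have hp : p.Prime := Fact.out
  obtain ⟨m, rfl⟩ : ∃ m, p = m + 1 := ⟨p - 1, by have := hp.pos; omega⟩
  refine ⟨∑ k ∈ Finset.range m, (((m + 1).choose (k + 1) / (m + 1) : ℕ) : ℤ) • Δ_[h] ^[k] f,
    Δ_[h] ^[m] f, sum _ fun k _ ↦ (iterate h (hD.mono (Nat.le_add_right _ _))).smul _,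
    iterate h (hD.mono hE), fun y ↦ ?_⟩
  rw [sum_range_shift_eq_sum_fwdDiff_iter_s7, Finset.sum_range_succ, Nat.choose_self, one_smul,
    Finset.sum_apply, Finset.mul_sum]
  congr 1
  refine Finset.sum_congr rfl fun k hk ↦ ?_
  have hdvd : m + 1 ∣ (m + 1).choose (k + 1) :=
    hp.dvd_choose_self (by omega) (by have := Finset.mem_range.mp hk; omega)
  obtain ⟨c, hc⟩ := hdvd
  rw [hc, Nat.mul_div_cancel_left _ (by omega), Pi.smul_apply]
  simp
  ring

lemma FwdDegreeLT.pow_dvd_sum {A : Type*} [AddCommMonoid A] {N : ℕ} (a : Fin N → A) (y : A)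
    {f : A → ℤ} {s j : ℕ} (hf : FwdDegreeLT ((j + 1) * (p - 1)) f) (hN : s + j = N) :
    (p : ℤ) ^ s ∣ ∑ x : Fin N → Fin p, f (y + ∑ i, (x i : ℕ) • a i) := by
  induction N generalizing s j f with
  | zero =>
    obtain rfl : s = 0 := by omega
    simp
  | succ N ih =>
    rcases s with _ | s
    · simp
    have hsum : ∑ x : Fin (N + 1) → Fin p, f (y + ∑ i, (x i : ℕ) • a i) =
        ∑ x : Fin N → Fin p, ∑ k ∈ Finset.range p,
          f ((y + ∑ i, (x i : ℕ) • a i.succ) + k • a 0) := by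
      rw [← (Fin.consEquiv fun _ ↦ Fin p).sum_comp, Fintype.sum_prod_type, Finset.sum_comm]
      refine Finset.sum_congr rfl fun x _ ↦ ?_
      rw [Finset.sum_range]
      refine Finset.sum_congr rfl fun k _ ↦ ?_
      simp [Fin.sum_univ_succ, Fin.consEquiv, add_assoc, add_comm (((k : ℕ)) • a 0)]
    obtain ⟨g, r, hg, hr, hgr⟩ := hf.exists_sum_shift_eq (p := p) (a 0) (E := j * (p - 1))
      (by rw [Nat.succ_mul])
    rw [hsum]
    simp_rw [hgr]
    rw [Finset.sum_add_distrib, ← Finset.mul_sum, pow_succ']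
    refine dvd_add (mul_dvd_mul_left _ (ih _ hg (by omega))) ?_
    rcases j with _ | j
    · rw [zero_mul] at hr
      have hr : r = 0 := hr
      simp [hr]
    · rw [← pow_succ']
      exact ih _ hr (by omega)

lemma exists_fwdDiff_iter_eq_of_periodic {f : ℕ → ℤ} (hf : Function.Periodic f p) (j : ℕ) :
    ∃ g : ℕ → ℤ, Function.Periodic g p ∧
      Δ_[1] ^[1 + j * (p - 1)] f = (p : ℤ) ^ j • Δ_[1] g := by
  have hp : p.Prime := Fact.out
  have periodic_iter : ∀ {u : ℕ → ℤ}, Function.Periodic u p → ∀ k,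
      Function.Periodic (Δ_[1] ^[k] u) p := by
    intro u hu k x
    rw [← fwdDiff_iter_comp_add]
    exact congrArg (fun v ↦ Δ_[1] ^[k] v x) (funext hu)
  induction j with
  | zero => exact ⟨f, hf, by simp⟩
  | succ j ih =>
    obtain ⟨u, hu, hfu⟩ := ih
    obtain ⟨m, rfl⟩ : ∃ m, p = m + 1 := ⟨p - 1, by have := hp.pos; omega⟩
    refine ⟨-∑ k ∈ Finset.range m, (((m + 1).choose (k + 1) / (m + 1) : ℕ) : ℤ) • Δ_[1] ^[k] u,
      fun x ↦ ?_, ?_⟩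
    · simp only [Pi.neg_apply, Finset.sum_apply, Pi.smul_apply]
      simp_rw [periodic_iter hu _ x]
    · have h1 : 1 + (j + 1) * (m + 1 - 1) = m + (1 + j * (m + 1 - 1)) := by
        rw [Nat.add_sub_cancel]; ring
      rw [h1, Function.iterate_add_apply, hfu, fwdDiff_iter_const_smul,
        ← Function.iterate_succ_apply, pow_succ, mul_smul]
      congr 1
      ext x
      have h2 := shift_eq_sum_fwdDiff_iter (1 : ℕ) u (m + 1) x
      rw [smul_eq_mul, mul_one, hu x, Finset.sum_range_succ', Finset.sum_range_succ] at h2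
      simp only [Nat.choose_self, one_smul, Nat.choose_zero_right, Function.iterate_zero, id] at h2
      have h3 : Δ_[1] (-∑ k ∈ Finset.range m,
          (((m + 1).choose (k + 1) / (m + 1) : ℕ) : ℤ) • Δ_[1] ^[k] u) =
          -∑ k ∈ Finset.range m,
          (((m + 1).choose (k + 1) / (m + 1) : ℕ) : ℤ) • Δ_[1] ^[k + 1] u := by
        have := fwdDiff_const_smul (1 : ℕ) (-1 : ℤ) (∑ k ∈ Finset.range m,
          (((m + 1).choose (k + 1) / (m + 1) : ℕ) : ℤ) • Δ_[1] ^[k] u)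
        rw [neg_one_smul, neg_one_smul] at this
        rw [this, fwdDiff_finsetSum]
        simp only [fwdDiff_const_smul, Function.iterate_succ_apply']
      have h4 : ∑ k ∈ Finset.range m, (m + 1).choose (k + 1) • Δ_[1] ^[k + 1] u x =
          ((m + 1 : ℕ) : ℤ) * ∑ k ∈ Finset.range m,
          (((m + 1).choose (k + 1) / (m + 1) : ℕ) : ℤ) * Δ_[1] ^[k + 1] u x := by
        rw [Finset.mul_sum]
        refine Finset.sum_congr rfl fun k hk ↦ ?_
        have hdvd : m + 1 ∣ (m + 1).choose (k + 1) :=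
          hp.dvd_choose_self (by omega) (by have := Finset.mem_range.mp hk; omega)
        obtain ⟨c, hc⟩ := hdvd
        rw [hc, Nat.mul_div_cancel_left _ (by omega), nsmul_eq_mul]
        push_cast
        ring
      rw [h3]
      simp only [Pi.smul_apply, Pi.neg_apply, Finset.sum_apply, smul_eq_mul]
      linarith

lemma exists_dvd_indicator_eq_sum_choose (p : ℕ) [Fact p.Prime] : ∃ a : ℕ → ℤ,
    (∀ k, (p : ℤ) ^ ((k - 1) / (p - 1)) ∣ a k) ∧
    ∀ y B : ℕ, y < B →
      (if p ∣ y then 1 else 0 : ℤ) = ∑ k ∈ Finset.range B, a k * (y.choose k : ℤ) := by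
  have hper : Function.Periodic (fun y : ℕ ↦ (if p ∣ y then 1 else 0 : ℤ)) p := by
    intro y
    simp
  refine ⟨fun k ↦ Δ_[1] ^[k] (fun y : ℕ ↦ (if p ∣ y then 1 else 0 : ℤ)) 0, fun k ↦ ?_,
    fun y B hy ↦ ?_⟩
  · rcases k with _ | k
    · simp
    obtain ⟨g, -, hg⟩ := exists_fwdDiff_iter_eq_of_periodic hper (k / (p - 1))
    have hk : k + 1 = (k % (p - 1)) + (1 + k / (p - 1) * (p - 1)) := by
      have := Nat.mod_add_div' k (p - 1)
      omega
    simp only [Nat.add_sub_cancel]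
    conv_rhs => rw [hk, Function.iterate_add_apply, hg, fwdDiff_iter_const_smul]
    exact dvd_mul_right _ _
  · have := shift_eq_sum_fwdDiff_iter (1 : ℕ) (fun y : ℕ ↦ (if p ∣ y then 1 else 0 : ℤ)) y 0
    simp only [zero_add, smul_eq_mul, mul_one] at this
    rw [this]
    refine (Finset.sum_subset ?_ fun k _ hk ↦ ?_).trans (Finset.sum_congr rfl fun k _ ↦ ?_)
    · simpa using hy
    · rw [Nat.choose_eq_zero_of_lt (by simpa using hk), zero_smul]
    · rw [nsmul_eq_mul, mul_comm]

/-- The **Ax–Katz theorem** over `𝔽_p` for functions of bounded functional degree. -/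
theorem FwdDegreeLT.pow_dvd_card_zeros {A ι : Type*} [AddCommMonoid A] [Fintype ι] {N d s : ℕ}
    (a : Fin N → A) {G : ι → A → ℕ} (hd : 1 ≤ d)
    (hG : ∀ i, FwdDegreeLT (d + 1) fun x ↦ (G i x : ℤ)) (hs : d * (s + Fintype.card ι) ≤ N) :
    (p : ℤ) ^ s ∣ ∑ x : Fin N → Fin p,
      ∏ i, (if p ∣ G i (∑ j, (x j : ℕ) • a j) then 1 else 0 : ℤ) := by
  classical
  have hp : p.Prime := Fact.out
  have hp2 := hp.two_le
  obtain ⟨c, hc, hcG⟩ := exists_dvd_indicator_eq_sum_choose p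
  set B := (∑ x : Fin N → Fin p, ∑ i, G i (∑ j, (x j : ℕ) • a j)) + 1 with hB
  have hlt : ∀ (x : Fin N → Fin p) (i : ι), G i (∑ j, (x j : ℕ) • a j) < B := by
    intro x i
    rw [hB, Nat.lt_succ_iff]
    exact (Finset.single_le_sum (f := fun i ↦ G i (∑ j, (x j : ℕ) • a j))
      (fun _ _ ↦ Nat.zero_le _) (Finset.mem_univ i)).trans
      (Finset.single_le_sum (f := fun x : Fin N → Fin p ↦ ∑ i, G i (∑ j, (x j : ℕ) • a j))
      (fun _ _ ↦ Nat.zero_le _) (Finset.mem_univ x))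
  have hexp : ∀ x : Fin N → Fin p,
      ∏ i, (if p ∣ G i (∑ j, (x j : ℕ) • a j) then 1 else 0 : ℤ) =
      ∑ κ ∈ Fintype.piFinset fun _ : ι ↦ Finset.range B,
        (∏ i, c (κ i)) * ∏ i, ((G i (∑ j, (x j : ℕ) • a j)).choose (κ i) : ℤ) := by
    intro x
    simp_rw [fun i ↦ hcG _ B (hlt x i), Finset.prod_univ_sum, Finset.prod_mul_distrib]
  simp_rw [hexp]
  rw [Finset.sum_comm]
  refine Finset.dvd_sum fun κ _ ↦ ?_
  rw [← Finset.mul_sum]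
  set u := ∑ i, (κ i - 1) / (p - 1) with hu
  have hcu : (p : ℤ) ^ u ∣ ∏ i, c (κ i) := by
    rw [hu, ← Finset.prod_pow_eq_pow_sum]
    exact Finset.prod_dvd_prod_of_dvd _ _ fun i _ ↦ hc _
  rcases le_or_gt s u with hsu | hsu
  · exact ((pow_dvd_pow _ hsu).trans hcu).mul_right _
  have hκ : ∑ i, κ i ≤ (u + Fintype.card ι) * (p - 1) := by
    rw [hu, add_mul, Finset.sum_mul, Fintype.card_eq_sum_ones, Finset.sum_mul,
      ← Finset.sum_add_distrib]
    refine Finset.sum_le_sum fun i _ ↦ ?_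
    have h1 := Nat.mod_add_div' (κ i - 1) (p - 1)
    have h2 := Nat.mod_lt (κ i - 1) (show 0 < p - 1 by omega)
    omega
  have hdeg : FwdDegreeLT ((d * (u + Fintype.card ι) + 1) * (p - 1))
      (∏ i, fun x ↦ ((G i x).choose (κ i) : ℤ)) := by
    refine mono ?_ (prod Finset.univ (n := fun i ↦ d * κ i) fun i _ ↦ (hG i).choose (κ i))
    rw [← Finset.mul_sum, add_mul, mul_assoc]
    exact Nat.add_le_add (Nat.mul_le_mul_left d hκ) (by omega)
  have hle : s - u + d * (u + Fintype.card ι) ≤ N := by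
    obtain ⟨v, rfl⟩ := Nat.exists_eq_add_of_lt hsu
    have : v + 1 ≤ d * (v + 1) := Nat.le_mul_of_pos_left _ hd
    have e : u + v + 1 - u = v + 1 := by omega
    rw [e]
    nlinarith
  have hsum := hdeg.pow_dvd_sum (p := p) a 0 (s := N - d * (u + Fintype.card ι)) (by omega)
  simp only [zero_add, Finset.prod_apply] at hsum
  have : (p : ℤ) ^ s = (p : ℤ) ^ u * (p : ℤ) ^ (s - u) := by rw [← pow_add]; congr 1; omega
  rw [this]
  exact mul_dvd_mul hcu ((pow_dvd_pow _ (by omega)).trans hsum)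

lemma MvPolynomial.totalDegree_aeval_le {σ τ R : Type*} [CommRing R] [Fintype σ]
    (F : MvPolynomial σ R) {l : σ → MvPolynomial τ R} (hl : ∀ j, (l j).totalDegree ≤ 1) :
    (aeval l F).totalDegree ≤ F.totalDegree := by
  rw [aeval_def, eval₂_eq']
  refine totalDegree_finsetSum_le fun e he ↦ ?_
  rw [algebraMap_eq]
  refine (totalDegree_mul _ _).trans ?_
  rw [totalDegree_C, zero_add]
  refine (totalDegree_finsetProd _ _).trans (le_trans ?_ (le_totalDegree he))
  rw [Finsupp.sum_fintype _ _ fun _ ↦ rfl]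
  refine Finset.sum_le_sum fun j _ ↦ (totalDegree_pow _ _).trans ?_
  simpa using Nat.mul_le_mul_left (e j) (hl j)

/-- The composite of a polynomial over `K` with an `𝔽_p`-linear form on `K` lifts, on points with
natural number coordinates, to a function of functional degree at most the total degree. -/
lemma MvPolynomial.exists_fwdDegreeLT_lift {K : Type*} [Field K] [Algebra (ZMod p) K] {N d : ℕ}
    (P : MvPolynomial (Fin N) K) (hP : P.totalDegree ≤ d) (φ : K →ₗ[ZMod p] ZMod p) :
    ∃ G : (Fin N → ℕ) → ℕ, FwdDegreeLT (d + 1) (fun x ↦ (G x : ℤ)) ∧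
      ∀ x, (G x : ZMod p) = φ (eval (fun k ↦ (x k : K)) P) := by
  refine ⟨fun x ↦ ∑ e ∈ P.support, (φ (coeff e P)).val * ∏ k, x k ^ e k, ?_, fun x ↦ ?_⟩
  · have h1 : (fun x : Fin N → ℕ ↦
        ((∑ e ∈ P.support, (φ (coeff e P)).val * ∏ k, x k ^ e k : ℕ) : ℤ)) =
        ∑ e ∈ P.support, ((φ (coeff e P)).val : ℤ) •
          ∏ k, (fun x : Fin N → ℕ ↦ (x k : ℤ)) ^ e k := by
      ext x
      simp only [Finset.sum_apply, Pi.smul_apply, smul_eq_mul, Finset.prod_apply, Pi.pow_apply]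
      push_cast
      rfl
    rw [h1]
    refine FwdDegreeLT.sum _ fun e he ↦ FwdDegreeLT.smul _ ?_
    have h2 : ∀ k, FwdDegreeLT 2 fun x : Fin N → ℕ ↦ (x k : ℤ) :=
      fun k ↦ FwdDegreeLT.of_additive fun x y ↦ by simp
    refine (FwdDegreeLT.prod Finset.univ fun k _ ↦ (h2 k).pow (e k)).mono ?_
    have h3 := (le_totalDegree he).trans hP
    rw [Finsupp.sum_fintype _ _ fun _ ↦ rfl] at h3
    simpa using h3
  · rw [eval_eq', map_sum, Nat.cast_sum]
    refine Finset.sum_congr rfl fun e _ ↦ ?_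
    have h4 : coeff e P * ∏ k, (x k : K) ^ e k = (∏ k, x k ^ e k) • coeff e P := by
      rw [nsmul_eq_mul, mul_comm]
      push_cast
      rfl
    rw [h4, map_nsmul, nsmul_eq_mul, Nat.cast_mul, ZMod.natCast_zmod_val, mul_comm]

lemma Submodule.exists_linearMap_separating {k K : Type*} [Field k] [AddCommGroup K] [Module k K]
    (W : Submodule k K) [FiniteDimensional k W] :
    ∃ φ : Fin (Module.finrank k W) → K →ₗ[k] k, ∀ w ∈ W, (∀ i, φ i w = 0) → w = 0 := by
  let b := Module.finBasis k W
  choose φ hφ using fun i ↦ (b.coord i).exists_extend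
  refine ⟨φ, fun w hw h ↦ ?_⟩
  have h0 : (⟨w, hw⟩ : W) = 0 := by
    refine b.ext_elem fun i ↦ ?_
    have := LinearMap.congr_fun (hφ i) ⟨w, hw⟩
    simpa [h i] using this.symm
  simpa using h0

lemma ZMod.bijective_natCast_fin : Function.Bijective fun j : Fin p ↦ ((j : ℕ) : ZMod p) := by
  rw [Fintype.bijective_iff_injective_and_card]
  refine ⟨fun i j hij ↦ ?_, by simp [ZMod.card]⟩
  have := congrArg ZMod.val hij
  simp only [ZMod.val_natCast_of_lt i.2, ZMod.val_natCast_of_lt j.2] at this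
  exact Fin.ext this

/-- The **Ax–Katz theorem** for a polynomial map between finite `𝔽_p`-subspaces of a field. -/
theorem MvPolynomial.pow_dvd_card_zeros {K : Type*} [Field K] [Algebra (ZMod p) K]
    (L W : Submodule (ZMod p) K) [FiniteDimensional (ZMod p) L] [FiniteDimensional (ZMod p) W]
    {n d s : ℕ} (F : MvPolynomial (Fin n) K) (hd : 1 ≤ d) (hFd : F.totalDegree ≤ d)
    (hFW : ∀ f : Fin n → K, (∀ j, f j ∈ L) → eval f F ∈ W)
    (hs : d * (s + Module.finrank (ZMod p) W) ≤ n * Module.finrank (ZMod p) L) :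
    p ^ s ∣ Nat.card {f : Fin n → K // (∀ j, f j ∈ L) ∧ eval f F = 0} := by
  classical
  obtain ⟨φ, hφ⟩ := W.exists_linearMap_separating
  have hN : Module.finrank (ZMod p) (Fin n → L) = n * Module.finrank (ZMod p) L := by
    simp [Module.finrank_pi_fintype]
  set N := n * Module.finrank (ZMod p) L
  let b := Module.finBasisOfFinrankEq (ZMod p) (Fin n → L) hN
  let l : Fin n → MvPolynomial (Fin N) K := fun j ↦ ∑ i, C (b i j : K) * X i
  have hl : ∀ j, (l j).totalDegree ≤ 1 := fun j ↦ totalDegree_finsetSum_le fun i _ ↦ by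
    refine (totalDegree_mul _ _).trans ?_
    simp
  choose G hG hGφ using fun i ↦
    (aeval l F).exists_fwdDegreeLT_lift ((F.totalDegree_aeval_le hl).trans hFd) (φ i)
  let e : (Fin N → Fin p) ≃ (Fin n → L) :=
    (Equiv.piCongrRight fun _ ↦ Equiv.ofBijective _ ZMod.bijective_natCast_fin).trans
      b.equivFun.symm.toEquiv
  have he : ∀ x j, (e x j : K) = ∑ i, (x i : ℕ) • (b i j : K) := by
    intro x j
    simp [e, Module.Basis.equivFun_symm_apply, Finset.sum_apply, Nat.cast_smul_eq_nsmul]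
  have heval : ∀ x : Fin N → Fin p,
      eval (fun k ↦ ((x k : ℕ) : K)) (aeval l F) = eval (fun j ↦ (e x j : K)) F := by
    intro x
    rw [← coe_aeval_eq_eval, ← coe_aeval_eq_eval, RingHom.coe_coe, RingHom.coe_coe,
      comp_aeval_apply]
    congr 2
    ext j
    simp [l, he, mul_comm]
  have hzero : ∀ x : Fin N → Fin p, (∀ i, p ∣ G i fun k ↦ (x k : ℕ)) ↔
      eval (fun j ↦ (e x j : K)) F = 0 := by
    intro x
    simp_rw [← ZMod.natCast_eq_zero_iff, hGφ, heval]
    exact ⟨hφ _ (hFW _ fun j ↦ (e x j).2), fun h i ↦ by rw [h, map_zero]⟩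
  have hsingle : ∀ x : Fin N → Fin p,
      ∑ j, (x j : ℕ) • (Pi.single j 1 : Fin N → ℕ) = fun k ↦ (x k : ℕ) := by
    intro x
    ext k
    simp [Finset.sum_apply, Pi.single_apply]
  have hdvd := FwdDegreeLT.pow_dvd_card_zeros (p := p) (s := s)
    (fun j : Fin N ↦ (Pi.single j 1 : Fin N → ℕ)) hd hG (by simpa using hs)
  simp_rw [hsingle, Finset.prod_boole, Finset.mem_univ, true_imp_iff, hzero, Finset.sum_boole]
    at hdvd
  have hcard : Nat.card {f : Fin n → K // (∀ j, f j ∈ L) ∧ eval f F = 0} =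
      (Finset.univ.filter fun x : Fin N → Fin p ↦ eval (fun j ↦ (e x j : K)) F = 0).card := by
    rw [← Fintype.card_subtype, ← Nat.card_eq_fintype_card]
    symm
    let ψ : {x : Fin N → Fin p // eval (fun j ↦ (e x j : K)) F = 0} →
        {f : Fin n → K // (∀ j, f j ∈ L) ∧ eval f F = 0} :=
      fun x ↦ ⟨fun j ↦ (e x.1 j : K), fun j ↦ (e x.1 j).2, x.2⟩
    refine Nat.card_eq_of_bijective ψ ⟨fun x y hxy ↦ ?_, ?_⟩
    · refine Subtype.ext (e.injective (_root_.funext fun j ↦ Subtype.ext ?_))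
      exact congrFun (congrArg Subtype.val hxy) j
    · rintro ⟨f, hf, hf0⟩
      have : ∀ j, (e (e.symm fun j ↦ ⟨f j, hf j⟩) j : K) = f j := by simp
      exact ⟨⟨e.symm fun j ↦ ⟨f j, hf j⟩, by simpa using hf0⟩, Subtype.ext (_root_.funext this)⟩
  rw [hcard]
  exact_mod_cast hdvd

lemma eventually_linear_le_of_growth {c C : ℝ} (hc : 0 < c) {m : ℕ} (hm : 2 ≤ m) (D : ℝ) :
    ∀ᶠ k : ℕ in Filter.atTop, D * k ≤ c * (k : ℝ) ^ m - C * (k : ℝ) ^ (m - 1) := by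
  obtain ⟨m, rfl⟩ := Nat.exists_eq_add_of_le hm
  filter_upwards [tendsto_natCast_atTop_atTop.eventually_ge_atTop ((C + |D|) / c),
    Filter.eventually_ge_atTop 1] with k hk hk1
  rw [div_le_iff₀ hc] at hk
  have hk1 : (1 : ℝ) ≤ k := by exact_mod_cast hk1
  have e1 : 2 + m - 1 = m + 1 := by omega
  rw [e1]
  have h1 : c * (k : ℝ) ^ (2 + m) - C * (k : ℝ) ^ (m + 1) = (k : ℝ) ^ m * ((k * c - C) * k) := by
    ring
  have h2 : |D| * k ≤ (k * c - C) * k := by gcongr; linarith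
  have h3 : D * k ≤ |D| * k := by gcongr; exact le_abs_self D
  have h4 : 0 ≤ (k * c - C) * k := le_trans (by positivity) h2
  rw [h1]
  nlinarith [one_le_pow₀ hk1 (n := m)]

lemma Padic.summable_of_forall_eventually_pow_dvd (u : ℕ → ℕ)
    (hu : ∀ B : ℕ, ∀ᶠ k in Filter.atTop, p ^ (B * k) ∣ u k) (x : ℚ_[p]) :
    Summable fun k ↦ (u k : ℚ_[p]) * x ^ k := by
  have hp : p.Prime := Fact.out
  have hp1 : (1 : ℝ) < p := by exact_mod_cast hp.one_lt
  have hp0 : (0 : ℝ) < p := by linarith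
  obtain ⟨B, hB⟩ := pow_unbounded_of_one_lt ‖x‖ hp1
  refine NonarchimedeanAddGroup.summable_of_tendsto_cofinite_zero ?_
  rw [Nat.cofinite_eq_atTop]
  refine squeeze_zero_norm' (a := fun k ↦ ((p : ℝ)⁻¹) ^ k) ?_
    (tendsto_pow_atTop_nhds_zero_of_lt_one (by positivity) (inv_lt_one_of_one_lt₀ hp1))
  filter_upwards [hu (B + 1)] with k hk
  have h1 : ‖(u k : ℚ_[p])‖ ≤ (p : ℝ) ^ (-(((B + 1) * k : ℕ) : ℤ)) := by
    have := (Padic.norm_int_le_pow_iff_dvd (p := p) (u k : ℤ) ((B + 1) * k)).mpr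
      (by exact_mod_cast hk)
    simpa using this
  rw [norm_mul, norm_pow]
  calc ‖(u k : ℚ_[p])‖ * ‖x‖ ^ k
      ≤ (p : ℝ) ^ (-(((B + 1) * k : ℕ) : ℤ)) * ((p : ℝ) ^ B) ^ k := by gcongr
    _ = ((p : ℝ)⁻¹) ^ k := by
      rw [zpow_neg, zpow_natCast, add_mul, one_mul, pow_add, pow_mul, inv_pow]
      field_simp

/-- Abstract form of Theorem 2 of the paper: for a degree-graded monoid `M`
with finitely many elements in each degree, a polynomial `F` of degree at most
`d` over an extension `K` of `𝔽_q`, and families of finite-dimensional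
`𝔽_q`-subspaces `L E`, `W E` of `K` such that `F` maps `(L E)ⁿ` into `W E` and
`n·dim L E − d·dim W E ≥ c·(deg E)^m − C·(deg E)^{m−1}` with `c > 0`, `m ≥ 2`,
the Riemann–Roch zeta function `∑_k M_k T^k` is `p`-adic entire. -/
theorem riemann_roch_zeta_padic_entire
    (p : ℕ) [Fact p.Prime] (q : ℕ) (hq : ∃ t : ℕ, 0 < t ∧ q = p ^ t)
    {𝔽 K : Type*} [Field 𝔽] [Fintype 𝔽] (hcard : Fintype.card 𝔽 = q)
    [Field K] [Algebra 𝔽 K]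
    {M : Type*} [AddCommMonoid M]
    (deg : M →+ ℕ) (hdeg : ∀ k : ℕ, {E : M | deg E = k}.Finite)
    (n d : ℕ) (hn : 1 ≤ n) (hd : 1 ≤ d)
    (F : MvPolynomial (Fin n) K) (hFd : F.totalDegree ≤ d)
    (L W : M → Submodule 𝔽 K)
    (hLfin : ∀ E, FiniteDimensional 𝔽 (L E))
    (hWfin : ∀ E, FiniteDimensional 𝔽 (W E))
    (hFW : ∀ E : M, ∀ f : Fin n → K,
      (∀ j, f j ∈ L E) → MvPolynomial.eval f F ∈ W E)
    (c C : ℝ) (hc : 0 < c) (m : ℕ) (hm : 2 ≤ m)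
    (hgrowth : ∀ E : M,
      c * ((deg E : ℝ)) ^ m - C * ((deg E : ℝ)) ^ (m - 1)
        ≤ (n : ℝ) * (Module.finrank 𝔽 (L E) : ℝ)
            - (d : ℝ) * (Module.finrank 𝔽 (W E) : ℝ)) :
    ∀ x : ℚ_[p],
      Summable fun k : ℕ =>
        ((∑ E ∈ (hdeg k).toFinset,
            Nat.card {f : Fin n → K //
              (∀ j, f j ∈ L E) ∧ MvPolynomial.eval f F = 0} : ℕ) : ℚ_[p]) * x ^ k := by
  have hp : p.Prime := Fact.out
  obtain ⟨t, ht, rfl⟩ := hq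
  have : CharP 𝔽 p := charP_of_card_eq_prime_pow hcard
  let _ : Algebra (ZMod p) 𝔽 := ZMod.algebra 𝔽 p
  let _ : Algebra (ZMod p) K := ((algebraMap 𝔽 K).comp (algebraMap (ZMod p) 𝔽)).toAlgebra
  have : IsScalarTower (ZMod p) 𝔽 K := IsScalarTower.of_algebraMap_eq fun _ ↦ rfl
  have hrank : Module.finrank (ZMod p) 𝔽 = t := by
    have h := Module.card_eq_pow_finrank (K := ZMod p) (V := 𝔽)
    rw [hcard, ZMod.card] at h
    exact (Nat.pow_right_injective hp.two_le h).symm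
  refine fun x ↦ Padic.summable_of_forall_eventually_pow_dvd _ (fun B ↦ ?_) x
  filter_upwards [eventually_linear_le_of_growth (C := C) hc hm (d * B : ℝ)] with k hk
  refine Finset.dvd_sum fun E hE ↦ ?_
  have hE : deg E = k := by simpa using hE
  have hLE := hLfin E
  have hWE := hWfin E
  have hfin : ∀ V : Submodule 𝔽 K, FiniteDimensional 𝔽 V →
      FiniteDimensional (ZMod p) (V.restrictScalars (ZMod p)) ∧
      Module.finrank (ZMod p) (V.restrictScalars (ZMod p)) = t * Module.finrank 𝔽 V := by
    intro V hV
    refine ⟨Module.Finite.trans (R := ZMod p) 𝔽 V, ?_⟩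
    rw [← hrank]
    exact (Module.finrank_mul_finrank (ZMod p) 𝔽 V).symm
  obtain ⟨hL1, hL2⟩ := hfin _ hLE
  obtain ⟨hW1, hW2⟩ := hfin _ hWE
  refine MvPolynomial.pow_dvd_card_zeros ((L E).restrictScalars (ZMod p))
    ((W E).restrictScalars (ZMod p)) F hd hFd (hFW E) ?_
  rw [hL2, hW2]
  have h1 := hgrowth E
  rw [hE] at h1
  have h2 : d * (B * k + Module.finrank 𝔽 (W E)) ≤ n * Module.finrank 𝔽 (L E) := by
    have : (d : ℝ) * (B * k + Module.finrank 𝔽 (W E)) ≤ n * Module.finrank 𝔽 (L E) := by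
      linarith
    exact_mod_cast this
  calc d * (B * k + t * Module.finrank 𝔽 (W E))
      ≤ d * (t * (B * k) + t * Module.finrank 𝔽 (W E)) := by
        exact Nat.mul_le_mul_left d (Nat.add_le_add_right (Nat.le_mul_of_pos_left _ ht) _)
    _ = t * (d * (B * k + Module.finrank 𝔽 (W E))) := by ring
    _ ≤ t * (n * Module.finrank 𝔽 (L E)) := by gcongr
    _ = n * (t * Module.finrank 𝔽 (L E)) := by ring
end
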